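/- There is an absolute constant C such that the following holds. Let x ≥ 3 and (log x)^{1.1} ≤ y ≤ x^{1/3}, let q ≥ 1 be an integer, δ ∈ ℝ, L = 2(1 + |δx|), let j be an integer with 0 ≤ j ≤ (log y)/(log 2), and let p be a prime dividing q. Define 𝔗_j(r) = max_{1 ≤ b ≤ r−1} #{(n₁, n₂) : n₁, n₂ positive y-smooth integers ≤ x/(2^j qLy) with n₁ ≡ n₂ + b (mod r)}. Then 𝔗_j(q/p) ≤ C·( Ψ(x/(2^j qLy), y)²·(q/p)^{−α(x,y)}·log x + y·Ψ(x/(2^j qLy), y) ). -/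

import Mathlib

open scoped Classical

noncomputable section

/-- `n` is `y`-smooth: every prime factor of `n` is at most `y`. -/
def IsSmooth (y : ℝ) (n : ℕ) : Prop := ∀ p : ℕ, p.Prime → p ∣ n → (p : ℝ) ≤ y

/-- `Ψ(X, y)`: the number of `y`-smooth integers `n` with `1 ≤ n ≤ X`. -/
def Psi (X y : ℝ) : ℕ := Nat.card {n : ℕ | 1 ≤ n ∧ (n : ℝ) ≤ X ∧ IsSmooth y n}

/-- `e(t) = exp(2πit)`. -/
def e2pi (t : ℝ) : ℂ := Complex.exp (2 * Real.pi * Complex.I * t)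

/-- `alphaEq x y a` says `a` solves `∑_{p ≤ y prime} log p / (p^a - 1) = log x`,
i.e. `a = α(x, y)`. -/
def alphaEq (x y a : ℝ) : Prop :=
  ∑ p ∈ (Finset.range (⌊y⌋₊ + 1)).filter Nat.Prime,
    Real.log p / ((p : ℝ) ^ a - 1) = Real.log x
/-- The number of ordered pairs of positive `y`-smooth integers `n₁, n₂ ≤ X`
with `n₁ ≡ n₂ + b (mod r)`. -/
def Tcount (y X : ℝ) (r b : ℕ) : ℕ :=
  Nat.card {nn : ℕ × ℕ | 1 ≤ nn.1 ∧ 1 ≤ nn.2 ∧ (nn.1 : ℝ) ≤ X ∧ (nn.2 : ℝ) ≤ X ∧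
    IsSmooth y nn.1 ∧ IsSmooth y nn.2 ∧ nn.1 ≡ nn.2 + b [MOD r]}

/-- `𝔗_j(r)`: the maximum over `1 ≤ b ≤ r − 1` of `Tcount y X r b`. -/
def Tmax (y X : ℝ) (r : ℕ) : ℕ := (Finset.Icc 1 (r - 1)).sup (Tcount y X r)

/-- The primes `p ≤ y`. -/
def primesUpTo (y : ℝ) : Finset ℕ := (Finset.range (⌊y⌋₊ + 1)).filter Nat.Prime

lemma mem_primesUpTo {y : ℝ} (hy : 0 ≤ y) {p : ℕ} :
    p ∈ primesUpTo y ↔ p.Prime ∧ (p : ℝ) ≤ y := by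
  simp only [primesUpTo, Finset.mem_filter, Finset.mem_range, Nat.lt_succ_iff, Nat.le_floor_iff hy]
  tauto

lemma prime_of_mem_primesUpTo {y : ℝ} {p : ℕ} (h : p ∈ primesUpTo y) : p.Prime :=
  (Finset.mem_filter.1 h).2

lemma primesUpTo_floor (y : ℝ) : primesUpTo (⌊y⌋₊ : ℕ) = primesUpTo y := by
  simp [primesUpTo]

lemma theta_eq_sum_primesUpTo (y : ℝ) :
    Chebyshev.theta y = ∑ p ∈ primesUpTo y, Real.log p := by
  rw [Chebyshev.theta]
  congr 1
  ext p
  simp only [primesUpTo, Finset.mem_filter, Finset.mem_Ioc, Finset.mem_range]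
  constructor
  · rintro ⟨⟨_, h⟩, hp⟩
    exact ⟨by omega, hp⟩
  · rintro ⟨h, hp⟩
    exact ⟨⟨hp.pos, by omega⟩, hp⟩

lemma log_factorial_eq_sum (N : ℕ) :
    Real.log (N.factorial : ℝ) =
      ∑ p ∈ primesUpTo N, (N.factorial.factorization p : ℝ) * Real.log p := by
  conv_lhs => rw [← Nat.prod_factorization_pow_eq_self (Nat.factorial_ne_zero N)]
  rw [Finsupp.prod_of_support_subset (s := primesUpTo N) _ _ _ (by simp)]
  · push_cast
    rw [Real.log_prod]
    · exact Finset.sum_congr rfl fun p _ => Real.log_pow _ _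
    · intro p hp
      have := (prime_of_mem_primesUpTo hp).pos
      positivity
  · intro p hp
    rw [Nat.support_factorization, Nat.mem_primeFactors] at hp
    rw [mem_primesUpTo (by positivity)]
    exact ⟨hp.1, by exact_mod_cast (hp.1.dvd_factorial).1 hp.2.1⟩

lemma sum_log_div_prime_le {N : ℕ} (hN : 1 ≤ N) :
    ∑ p ∈ primesUpTo N, Real.log p / p ≤ Real.log N + Real.log 4 := by
  have hN0 : (0 : ℝ) < N := by exact_mod_cast hN
  have h1 : Real.log (N.factorial : ℝ) ≤ N * Real.log N := by
    rw [← Real.log_pow]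
    exact Real.log_le_log (by exact_mod_cast N.factorial_pos)
      (by exact_mod_cast N.factorial_le_pow)
  have h2 : ∑ p ∈ primesUpTo N, ((N : ℝ) / p - 1) * Real.log p ≤ Real.log (N.factorial : ℝ) := by
    rw [log_factorial_eq_sum]
    refine Finset.sum_le_sum fun p hp => ?_
    have hpp := prime_of_mem_primesUpTo hp
    refine mul_le_mul_of_nonneg_right ?_ (Real.log_natCast_nonneg p)
    have hdvd : p ^ (N / p) ∣ N.factorial := by
      have h3 : p ^ (N / p) * (N / p).factorial ∣ (p * (N / p)).factorial := by
        rw [mul_comm p (N / p)]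
        generalize N / p = k
        induction k with
        | zero => simp
        | succ k ih =>
          have : (k + 1) * p = k * p + (p - 1) + 1 := by
            have := hpp.pos
            have e : (k+1)*p = k*p + p := by ring
            omega
          rw [this, Nat.factorial_succ (k * p + (p - 1)), ← this, Nat.factorial_succ, pow_succ]
          have h4 : (k * p).factorial ∣ (k * p + (p - 1)).factorial :=
            Nat.factorial_dvd_factorial (by omega)
          have : p ^ k * p * ((k + 1) * k.factorial) = ((k + 1) * p) * (p ^ k * k.factorial) := by
            ring
          rw [this]
          exact mul_dvd_mul_left _ (ih.trans h4)
      exact ((dvd_mul_right _ _).trans h3).trans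
        (Nat.factorial_dvd_factorial (Nat.mul_div_le N p))
    have h5 : N / p ≤ N.factorial.factorization p :=
      (hpp.pow_dvd_iff_le_factorization (Nat.factorial_ne_zero N)).1 hdvd
    have h6 : (N : ℝ) / p - 1 ≤ ((N / p : ℕ) : ℝ) := by
      have := Nat.lt_floor_add_one ((N : ℝ) / p)
      rw [Nat.floor_div_eq_div] at this
      linarith
    exact h6.trans (by exact_mod_cast h5)
  have h3 : ∑ p ∈ primesUpTo N, ((N : ℝ) / p - 1) * Real.log p =
      N * ∑ p ∈ primesUpTo N, Real.log p / p - Chebyshev.theta N := by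
    rw [theta_eq_sum_primesUpTo, Finset.mul_sum, ← Finset.sum_sub_distrib]
    exact Finset.sum_congr rfl fun p _ => by ring
  have h4 := Chebyshev.theta_le_log4_mul_x hN0.le
  have h5 : (N : ℝ) * ∑ p ∈ primesUpTo N, Real.log p / p ≤ N * (Real.log N + Real.log 4) := by
    linarith
  exact le_of_mul_le_mul_left h5 hN0

lemma le_sum_log_div_pred {N : ℕ} (hN : 1 ≤ N) :
    Real.log N - 1 ≤ ∑ p ∈ primesUpTo N, Real.log p / (p - 1) := by
  have hN0 : (0 : ℝ) < N := by exact_mod_cast hN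
  have h1 : N * Real.log N - N ≤ Real.log (N.factorial : ℝ) := by
    have h := Real.pow_div_factorial_le_exp (N : ℝ) hN0.le N
    have hf : (0 : ℝ) < N.factorial := by exact_mod_cast N.factorial_pos
    have h' := Real.log_le_log (by positivity) h
    rw [Real.log_exp, Real.log_div (by positivity) (by positivity), Real.log_pow] at h'
    linarith
  have h2 : Real.log (N.factorial : ℝ) ≤ N * ∑ p ∈ primesUpTo N, Real.log p / (p - 1) := by
    rw [log_factorial_eq_sum, Finset.mul_sum]
    refine Finset.sum_le_sum fun p hp => ?_
    have hpp := prime_of_mem_primesUpTo hp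
    have h3 := Nat.factorization_factorial_le_div_pred hpp N
    have h4 : ((N / (p - 1) : ℕ) : ℝ) ≤ N / (p - 1) := by
      refine Nat.cast_div_le.trans ?_
      rw [Nat.cast_sub hpp.one_le, Nat.cast_one]
    have h5 : (N.factorial.factorization p : ℝ) ≤ N / (p - 1) := le_trans (by exact_mod_cast h3) h4
    calc _ ≤ (N : ℝ) / (p - 1) * Real.log p :=
          mul_le_mul_of_nonneg_right h5 (Real.log_natCast_nonneg p)
      _ = _ := by ring
  have h5 : (N : ℝ) * (Real.log N - 1) ≤ N * ∑ p ∈ primesUpTo N, Real.log p / (p - 1) := by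
    linarith
  exact le_of_mul_le_mul_left h5 hN0

lemma exists_sum_log_div_mul_pred_le :
    ∃ C : ℝ, 0 < C ∧ ∀ y : ℝ, ∑ p ∈ primesUpTo y, Real.log p / (p * (p - 1)) ≤ C := by
  have hs : Summable fun n : ℕ => 4 * (1 / (n : ℝ) ^ (3 / 2 : ℝ)) :=
    (Real.summable_one_div_nat_rpow.2 (by norm_num)).mul_left 4
  refine ⟨∑' n : ℕ, 4 * (1 / (n : ℝ) ^ (3 / 2 : ℝ)) + 1,
    add_pos_of_nonneg_of_pos (tsum_nonneg fun n => by positivity) one_pos, fun y => ?_⟩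
  have h : ∑ p ∈ primesUpTo y, Real.log p / (p * (p - 1)) ≤
      ∑ p ∈ primesUpTo y, 4 * (1 / (p : ℝ) ^ (3 / 2 : ℝ)) := by
    refine Finset.sum_le_sum fun p hp => ?_
    have h2 : (2 : ℝ) ≤ p := by exact_mod_cast (prime_of_mem_primesUpTo hp).two_le
    have h3 := Real.log_le_rpow_div (x := p) (by positivity) (ε := 1 / 2) (by norm_num)
    have h4 : (p : ℝ) ^ (3 / 2 : ℝ) * (p : ℝ) ^ (1 / 2 : ℝ) = p * p := by
      rw [← Real.rpow_add (by positivity), ← sq, ← Real.rpow_natCast]; norm_num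
    have hpos : (0 : ℝ) < (p : ℝ) ^ (3 / 2 : ℝ) := by positivity
    rw [mul_one_div, div_le_div_iff₀ (by nlinarith) hpos]
    calc Real.log p * (p : ℝ) ^ (3 / 2 : ℝ)
        ≤ ((p : ℝ) ^ (1 / 2 : ℝ) / (1 / 2)) * (p : ℝ) ^ (3 / 2 : ℝ) :=
          mul_le_mul_of_nonneg_right h3 hpos.le
      _ = 2 * (p * p) := by rw [← h4]; ring
      _ ≤ 4 * (p * (p - 1)) := by nlinarith
  linarith [hs.sum_le_tsum (primesUpTo y) fun n _ => by positivity]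

/-- A lower bound of Mertens type for primes in an interval. -/
lemma exists_mertens_interval :
    ∃ C : ℝ, 0 < C ∧ ∀ a b : ℝ, 1 ≤ a → a ≤ b →
      Real.log (b / a) - C ≤ ∑ p ∈ (primesUpTo b).filter (fun p : ℕ => a < p), Real.log p / p := by
  obtain ⟨C, hC, h⟩ := exists_sum_log_div_mul_pred_le
  have hl2 := Real.log_pos one_lt_two
  have hl4 := Real.log_pos (show (1 : ℝ) < 4 by norm_num)
  refine ⟨C + 1 + Real.log 2 + Real.log 4, by positivity, fun a b ha hab => ?_⟩
  have hb : 1 ≤ b := ha.trans hab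
  have hfl : ∀ t : ℝ, 1 ≤ t → 1 ≤ ⌊t⌋₊ := fun t ht => Nat.le_floor (by simpa using ht)
  have hup : ∑ p ∈ primesUpTo a, Real.log p / p ≤ Real.log a + Real.log 4 := by
    have := sum_log_div_prime_le (hfl a ha)
    rw [primesUpTo_floor] at this
    have h2 : Real.log (⌊a⌋₊ : ℕ) ≤ Real.log a :=
      Real.log_le_log (by exact_mod_cast hfl a ha) (Nat.floor_le (by linarith))
    linarith
  have hlow : Real.log b - Real.log 2 - 1 - C ≤ ∑ p ∈ primesUpTo b, Real.log p / p := by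
    have h1 := le_sum_log_div_pred (hfl b hb)
    rw [primesUpTo_floor] at h1
    have h2 : Real.log b ≤ Real.log (⌊b⌋₊ : ℕ) + Real.log 2 := by
      rw [← Real.log_mul (by have := hfl b hb; positivity) (by norm_num)]
      refine Real.log_le_log (by linarith) ?_
      have h3 := Nat.lt_floor_add_one b
      have h4 : (1 : ℝ) ≤ ⌊b⌋₊ := by exact_mod_cast hfl b hb
      linarith
    have h3 : ∑ p ∈ primesUpTo b, Real.log p / (p - 1) =
        ∑ p ∈ primesUpTo b, Real.log p / p + ∑ p ∈ primesUpTo b, Real.log p / (p * (p - 1)) := by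
      rw [← Finset.sum_add_distrib]
      refine Finset.sum_congr rfl fun p hp => ?_
      have h2 : (2 : ℝ) ≤ p := by exact_mod_cast (prime_of_mem_primesUpTo hp).two_le
      have h3 : (p : ℝ) - 1 ≠ 0 := by linarith
      field_simp
      ring
    linarith [h b]
  have hsplit := Finset.sum_filter_add_sum_filter_not (primesUpTo b) (fun p : ℕ => a < p)
    (fun p => Real.log p / p)
  have hsub : ∑ p ∈ (primesUpTo b).filter (fun p : ℕ => ¬ a < p), Real.log p / p ≤
      ∑ p ∈ primesUpTo a, Real.log p / p := by
    refine Finset.sum_le_sum_of_subset_of_nonneg (fun p hp => ?_) fun p _ _ =>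
      div_nonneg (Real.log_natCast_nonneg p) (Nat.cast_nonneg p)
    rw [Finset.mem_filter] at hp
    rw [mem_primesUpTo (by linarith)]
    exact ⟨prime_of_mem_primesUpTo hp.1, not_lt.1 hp.2⟩
  rw [Real.log_div (by linarith) (by linarith)]
  linarith

/-- Chebyshev's lower bound, with an unspecified constant. -/
lemma exists_mul_le_theta :
    ∃ c : ℝ, ∃ y₀ : ℝ, 0 < c ∧ 1 ≤ y₀ ∧ ∀ y : ℝ, y₀ ≤ y → c * y ≤ Chebyshev.theta y := by
  obtain ⟨C, hC, h⟩ := exists_mertens_interval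
  have he : (1 : ℝ) ≤ Real.exp (C + 1) := Real.one_le_exp (by linarith)
  refine ⟨Real.exp (-(C + 1)), Real.exp (C + 1), Real.exp_pos _, he, fun y hy => ?_⟩
  have hy0 : 0 < y := by linarith
  have h1 := h (y / Real.exp (C + 1)) y ((one_le_div (by positivity)).2 hy)
    (div_le_self hy0.le he)
  have h2 : Real.log (y / (y / Real.exp (C + 1))) = C + 1 := by
    rw [div_div_cancel₀ hy0.ne', Real.log_exp]
  rw [h2] at h1
  have h3 : ∑ p ∈ (primesUpTo y).filter (fun p : ℕ => y / Real.exp (C + 1) < p), Real.log p / p ≤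
      Real.exp (C + 1) / y * Chebyshev.theta y := by
    rw [theta_eq_sum_primesUpTo, Finset.mul_sum]
    refine (Finset.sum_le_sum fun p hp => ?_).trans
      (Finset.sum_le_sum_of_subset_of_nonneg (Finset.filter_subset _ _) fun p _ _ => ?_)
    · rw [Finset.mem_filter] at hp
      have hp0 : (0 : ℝ) < p := lt_trans (by positivity) hp.2
      rw [div_eq_inv_mul]
      refine mul_le_mul_of_nonneg_right ?_ (Real.log_natCast_nonneg p)
      rw [← inv_div]
      exact inv_anti₀ (by positivity) hp.2.le
    · have := Real.log_natCast_nonneg p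
      positivity
  have h4 : 1 ≤ Real.exp (C + 1) / y * Chebyshev.theta y := by linarith
  rw [Real.exp_neg, inv_mul_le_iff₀ (by positivity)]
  rw [div_mul_eq_mul_div, one_le_div hy0] at h4
  exact h4

/-- The positive integers `n ≤ N` satisfying `Q`. -/
def countSet (Q : ℕ → Prop) (N : ℕ) : Finset ℕ := (Finset.Icc 1 N).filter Q

lemma mem_countSet {Q : ℕ → Prop} {N n : ℕ} : n ∈ countSet Q N ↔ (1 ≤ n ∧ n ≤ N) ∧ Q n := by
  simp [countSet]

lemma countSet_mono_right {Q : ℕ → Prop} {M N : ℕ} (h : M ≤ N) : countSet Q M ⊆ countSet Q N := by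
  intro n hn
  rw [mem_countSet] at hn ⊢
  exact ⟨⟨hn.1.1, hn.1.2.trans h⟩, hn.2⟩

lemma card_countSet_mul_log (Q : ℕ → Prop) (N : ℕ) :
    ((countSet Q N).card : ℝ) * Real.log N =
      ∑ m ∈ Finset.range N, ((countSet Q m).card : ℝ) * (Real.log (m + 1) - Real.log m) +
        ∑ n ∈ countSet Q N, Real.log n := by
  induction N with
  | zero => simp [countSet]
  | succ N ih =>
    have hset : countSet Q (N + 1) =
        if Q (N + 1) then insert (N + 1) (countSet Q N) else countSet Q N := by
      ext n
      split_ifs with h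
      · simp only [Finset.mem_insert, mem_countSet]
        constructor
        · rintro ⟨⟨h1, h2⟩, h3⟩
          rcases Nat.lt_or_ge N n with h4 | h4
          · exact Or.inl (by omega)
          · exact Or.inr ⟨⟨h1, h4⟩, h3⟩
        · rintro (rfl | ⟨⟨h1, h2⟩, h3⟩)
          · exact ⟨⟨by omega, le_rfl⟩, h⟩
          · exact ⟨⟨h1, by omega⟩, h3⟩
      · simp only [mem_countSet]
        constructor
        · rintro ⟨⟨h1, h2⟩, h3⟩
          refine ⟨⟨h1, ?_⟩, h3⟩
          by_contra h4
          exact h ((by omega : n = N + 1) ▸ h3)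
        · rintro ⟨⟨h1, h2⟩, h3⟩
          exact ⟨⟨h1, by omega⟩, h3⟩
    have hnot : N + 1 ∉ countSet Q N := by simp [mem_countSet]
    rw [Finset.sum_range_succ, hset]
    push_cast
    split_ifs with h
    · rw [Finset.card_insert_of_notMem hnot, Finset.sum_insert hnot]
      push_cast
      linear_combination ih
    · linear_combination ih

lemma log_eq_sum_of_isSmooth {y : ℝ} (hy : 0 ≤ y) {n N : ℕ} (hn : 1 ≤ n) (hnN : n ≤ N)
    (hs : IsSmooth y n) :
    Real.log n = ∑ p ∈ primesUpTo y, ∑ k ∈ Finset.Icc 1 N, if p ^ k ∣ n then Real.log p else 0 := by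
  have hn0 : n ≠ 0 := by omega
  conv_lhs => rw [← Nat.prod_factorization_pow_eq_self hn0]
  rw [Finsupp.prod_of_support_subset (s := primesUpTo y) _ _ _ (by simp)]
  · push_cast
    rw [Real.log_prod]
    · refine Finset.sum_congr rfl fun p hp => ?_
      have hpp := prime_of_mem_primesUpTo hp
      rw [Real.log_pow, Nat.factorization_eq_card_pow_dvd_of_lt (b := N + 1) hpp hn
        (hnN.trans_lt ((Nat.lt_pow_self hpp.one_lt).trans
          (Nat.pow_lt_pow_right hpp.one_lt (Nat.lt_succ_self N)))), ← Finset.sum_filter,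
        Finset.sum_const, nsmul_eq_mul]
      rfl
    · intro p hp
      have := (prime_of_mem_primesUpTo hp).pos
      positivity
  · intro p hp
    rw [Nat.support_factorization, Nat.mem_primeFactors] at hp
    rw [mem_primesUpTo hy]
    exact ⟨hp.1, hs p hp.1 hp.2.1⟩

lemma sum_log_countSet {y : ℝ} (hy : 0 ≤ y) {Q : ℕ → Prop} (hQ : ∀ n, Q n → IsSmooth y n) (N : ℕ) :
    ∑ n ∈ countSet Q N, Real.log n = ∑ p ∈ primesUpTo y, ∑ k ∈ Finset.Icc 1 N,
      (((countSet Q N).filter (fun n => p ^ k ∣ n)).card : ℝ) * Real.log p := by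
  have h : ∀ n ∈ countSet Q N, Real.log n = ∑ p ∈ primesUpTo y, ∑ k ∈ Finset.Icc 1 N,
      if p ^ k ∣ n then Real.log p else 0 := by
    intro n hn
    rw [mem_countSet] at hn
    exact log_eq_sum_of_isSmooth hy hn.1.1 hn.1.2 (hQ n hn.2)
  rw [Finset.sum_congr rfl h, Finset.sum_comm]
  refine Finset.sum_congr rfl fun p _ => ?_
  rw [Finset.sum_comm]
  refine Finset.sum_congr rfl fun k _ => ?_
  rw [← Finset.sum_filter, Finset.sum_const, nsmul_eq_mul]

lemma IsSmooth.mul {y : ℝ} {m n : ℕ} (hm : IsSmooth y m) (hn : IsSmooth y n) :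
    IsSmooth y (m * n) := by
  intro p hp h
  rcases hp.dvd_mul.1 h with h | h
  exacts [hm p hp h, hn p hp h]

lemma IsSmooth.of_dvd {y : ℝ} {m n : ℕ} (hn : IsSmooth y n) (h : m ∣ n) : IsSmooth y m :=
  fun p hp hpm => hn p hp (hpm.trans h)

lemma isSmooth_of_le {y : ℝ} {n : ℕ} (h1 : 1 ≤ n) (h : (n : ℝ) ≤ y) : IsSmooth y n :=
  fun p _ hpn => le_trans (by exact_mod_cast Nat.le_of_dvd h1 hpn) h

lemma isSmooth_prime_pow {y : ℝ} {p : ℕ} (hp : p.Prime) (h : (p : ℝ) ≤ y) (k : ℕ) :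
    IsSmooth y (p ^ k) := by
  intro q hq hqp
  rwa [(Nat.prime_dvd_prime_iff_eq hq hp).1 (hq.dvd_of_dvd_pow hqp)]

lemma Psi_eq_card (V y : ℝ) : Psi V y = (countSet (IsSmooth y) ⌊V⌋₊).card := by
  have h : {n : ℕ | 1 ≤ n ∧ (n : ℝ) ≤ V ∧ IsSmooth y n} =
      (countSet (IsSmooth y) ⌊V⌋₊ : Set ℕ) := by
    ext n
    rw [Finset.mem_coe, mem_countSet, Set.mem_ofPred_eq, and_assoc]
    refine and_congr_right fun h1 => ?_
    rw [Nat.le_floor_iff' (by omega)]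
  rw [Psi, h, Nat.card_coe_set_eq, Set.ncard_coe_finset]

lemma Psi_natCast (N : ℕ) (y : ℝ) : Psi N y = (countSet (IsSmooth y) N).card := by
  rw [Psi_eq_card, Nat.floor_natCast]

lemma Psi_mono {V W y : ℝ} (h : V ≤ W) : Psi V y ≤ Psi W y := by
  rw [Psi_eq_card, Psi_eq_card]
  exact Finset.card_le_card (countSet_mono_right (Nat.floor_mono h))

lemma Psi_div_pow_le_card {y : ℝ} {p : ℕ} (hp : p.Prime) (hpy : (p : ℝ) ≤ y) (k N : ℕ) :
    Psi ((N : ℝ) / p ^ k) y ≤ ((countSet (IsSmooth y) N).filter (fun n => p ^ k ∣ n)).card := by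
  have e : ⌊(N : ℝ) / (p : ℝ) ^ k⌋₊ = N / p ^ k := by
    have := Nat.floor_div_eq_div (K := ℝ) N (p ^ k)
    exact_mod_cast this
  rw [Psi_eq_card, e]
  have hpk : 0 < p ^ k := Nat.pow_pos hp.pos
  refine Finset.card_le_card_of_injOn (fun m => p ^ k * m) ?_ ?_
  · intro m hm
    rw [Finset.mem_coe, mem_countSet] at hm
    rw [Finset.mem_coe, Finset.mem_filter, mem_countSet]
    refine ⟨⟨⟨Nat.mul_pos hpk hm.1.1, ?_⟩, (isSmooth_prime_pow hp hpy k).mul hm.2⟩,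
      dvd_mul_right _ _⟩
    exact (Nat.mul_le_mul_left _ hm.1.2).trans (Nat.mul_div_le N (p ^ k))
  · intro a _ b _ hab
    exact Nat.eq_of_mul_eq_mul_left hpk hab

/-- The basic inequality `∑_{m<N} Ψ(m) log((m+1)/m) + ∑_{p, k} Ψ(N/p^k) log p ≤ Ψ(N) log N`. -/
lemma sum_Psi_le {y : ℝ} (hy : 0 ≤ y) (N : ℕ) :
    ∑ m ∈ Finset.range N, (Psi m y : ℝ) * (Real.log (m + 1) - Real.log m) +
      ∑ p ∈ primesUpTo y, ∑ k ∈ Finset.Icc 1 N, (Psi ((N : ℝ) / p ^ k) y : ℝ) * Real.log p ≤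
    (Psi N y : ℝ) * Real.log N := by
  rw [Psi_natCast, card_countSet_mul_log, sum_log_countSet hy (fun _ h => h)]
  simp only [Psi_natCast]
  refine add_le_add_right (Finset.sum_le_sum fun p hp => Finset.sum_le_sum fun k _ => ?_) _
  refine mul_le_mul_of_nonneg_right ?_ (Real.log_natCast_nonneg p)
  exact_mod_cast Psi_div_pow_le_card (prime_of_mem_primesUpTo hp)
    ((mem_primesUpTo hy).1 hp).2 k N

lemma sum_Psi_div_pow_le {y V : ℝ} (hy : 0 ≤ y) (hV : 1 ≤ V) {K : ℕ → ℕ}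
    (hK : ∀ p ∈ primesUpTo y, (p : ℝ) ^ K p ≤ V) :
    ∑ p ∈ primesUpTo y, ∑ k ∈ Finset.Icc 1 (K p), (Psi (V / p ^ k) y : ℝ) * Real.log p ≤
    (Psi V y : ℝ) * Real.log V := by
  set N := ⌊V⌋₊ with hN
  have hN1 : 1 ≤ N := Nat.le_floor (by simpa using hV)
  have hfl : ∀ p k : ℕ, (Psi (V / p ^ k) y : ℝ) = Psi ((N : ℝ) / p ^ k) y := by
    intro p k
    rw [Psi_eq_card, Psi_eq_card]
    have e : ⌊(N : ℝ) / (p : ℝ) ^ k⌋₊ = N / p ^ k := by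
      have := Nat.floor_div_eq_div (K := ℝ) N (p ^ k)
      exact_mod_cast this
    have e' : ⌊V / (p : ℝ) ^ k⌋₊ = N / p ^ k := by
      have := Nat.floor_div_natCast V (p ^ k)
      exact_mod_cast this
    rw [e, e']
  have h1 := sum_Psi_le hy N
  have h2 : 0 ≤ ∑ m ∈ Finset.range N, (Psi m y : ℝ) * (Real.log (m + 1) - Real.log m) := by
    refine Finset.sum_nonneg fun m _ => mul_nonneg (Nat.cast_nonneg _) ?_
    rcases Nat.eq_zero_or_pos m with rfl | hm
    · simp
    · rw [sub_nonneg]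
      exact Real.log_le_log (by exact_mod_cast hm) (by linarith)
  have h3 : Psi V y = Psi N y := by rw [Psi_eq_card, Psi_natCast]
  have h4 : (Psi N y : ℝ) * Real.log N ≤ Psi N y * Real.log V :=
    mul_le_mul_of_nonneg_left (Real.log_le_log (by exact_mod_cast hN1)
      (Nat.floor_le (by linarith))) (Nat.cast_nonneg _)
  rw [h3]
  refine le_trans (Finset.sum_le_sum fun p hp => ?_) ((le_add_of_nonneg_left h2).trans (h1.trans h4))
  simp only [hfl]
  refine Finset.sum_le_sum_of_subset_of_nonneg (Finset.Icc_subset_Icc_right ?_) fun k _ _ =>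
    mul_nonneg (Nat.cast_nonneg _) (Real.log_natCast_nonneg p)
  have h5 : p ^ K p ≤ N := Nat.le_floor (by exact_mod_cast hK p hp)
  exact (Nat.lt_pow_self (prime_of_mem_primesUpTo hp).one_lt).le.trans h5

lemma sum_Icc_pow_eq {q : ℝ} (hq : q < 1) (K : ℕ) :
    ∑ k ∈ Finset.Icc 1 K, q ^ k = q / (1 - q) - q ^ (K + 1) / (1 - q) := by
  have h : 1 - q ≠ 0 := by linarith
  induction K with
  | zero => simp
  | succ K ih =>
    rw [Finset.sum_Icc_succ_top (by omega), ih]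
    field_simp
    ring

lemma rpow_neg_prime_le {α : ℝ} (hα : 1 / 20 ≤ α) {p : ℕ} (hp : p.Prime) :
    (p : ℝ) ^ (-α) ≤ 29 / 30 := by
  have h2 : (2 : ℝ) ≤ p := by exact_mod_cast hp.two_le
  have h1 : (30 / 29 : ℝ) ≤ 2 ^ (1 / 20 : ℝ) := by
    rw [one_div, Real.le_rpow_inv_iff_of_pos (by norm_num) (by norm_num) (by norm_num)]
    norm_num
  have h3 : (2 : ℝ) ^ (1 / 20 : ℝ) ≤ p ^ α :=
    (Real.rpow_le_rpow_of_exponent_le (by norm_num) hα).trans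
      (Real.rpow_le_rpow (by norm_num) h2 (by linarith))
  rw [Real.rpow_neg (by linarith), inv_le_comm₀ (by positivity) (by norm_num)]
  exact le_trans (by norm_num) (h1.trans h3)

/-- If `Ψ(V, y)` dominates `V ^ α` on a multiplicative window of length `y`, it does so up to `x`,
where `α = α(x, y)`. -/
lemma Psi_ge_of_window {x y α B η : ℝ} (hα : 1 / 20 ≤ α) (hy : 2 ≤ y)
    (hsum : alphaEq x y α) (hθ : 2 * Real.log x ≤ Chebyshev.theta y) (hB : 1 ≤ B) (hη : 0 ≤ η)
    (hbase : ∀ V, B ≤ V → V ≤ B * y → V ≤ x → η * (V ^ α + 60 * B ^ α) ≤ Psi V y) :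
    ∀ V, B ≤ V → V ≤ x → η * (V ^ α + 60 * B ^ α) ≤ Psi V y := by
  have hsum' : ∑ p ∈ primesUpTo y, Real.log p / ((p : ℝ) ^ α - 1) = Real.log x := hsum
  suffices H : ∀ n : ℕ, ∀ V, V < 2 ^ n → B ≤ V → V ≤ x → η * (V ^ α + 60 * B ^ α) ≤ Psi V y by
    intro V hV hVx
    obtain ⟨n, hn⟩ := pow_unbounded_of_one_lt V one_lt_two
    exact H n V hn hV hVx
  intro n
  induction n with
  | zero => intro V h1 h2; simp at h1; linarith
  | succ n ih =>
    intro V hVn hVB hVx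
    rcases le_or_gt V (B * y) with h | hVy
    · exact hbase V hVB h hVx
    have hV0 : 0 < V := by linarith
    have hB0 : 0 < B := by linarith
    have hVB1 : 1 ≤ V / B := (one_le_div hB0).2 hVB
    have hx1 : 1 < x := by nlinarith
    have hlx : 0 < Real.log x := Real.log_pos hx1
    set K : ℕ → ℕ := fun p => Nat.log p ⌊V / B⌋₊ with hK
    have hfl : ⌊V / B⌋₊ ≠ 0 := by
      have : 1 ≤ ⌊V / B⌋₊ := Nat.le_floor (by simpa using hVB1)
      omega
    have hKle : ∀ p : ℕ, (p : ℝ) ^ K p ≤ V / B := by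
      intro p
      have := Nat.pow_log_le_self p hfl
      exact le_trans (by exact_mod_cast this) (Nat.floor_le (by linarith))
    have hKlt : ∀ p : ℕ, p.Prime → V / B < (p : ℝ) ^ (K p + 1) := by
      intro p hp
      have := Nat.lt_pow_succ_log_self hp.one_lt ⌊V / B⌋₊
      have h2 := (Nat.floor_lt (by linarith)).1 this
      exact_mod_cast h2
    have hK1 : ∀ p ∈ primesUpTo y, 1 ≤ K p := by
      intro p hp
      obtain ⟨hpp, hpy⟩ := (mem_primesUpTo (by linarith)).1 hp
      by_contra hcon
      have h0 : K p = 0 := by omega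
      have h2 := hKlt p hpp
      rw [h0, zero_add, pow_one, div_lt_iff₀ hB0] at h2
      nlinarith
    have hmain := sum_Psi_div_pow_le (y := y) (V := V) (K := K) (by linarith) (by linarith)
      fun p _ => (hKle p).trans (div_le_self hV0.le hB)
    have hterm : ∀ p ∈ primesUpTo y,
        η * V ^ α * (Real.log p / ((p : ℝ) ^ α - 1)) + 30 * η * B ^ α * Real.log p ≤
        ∑ k ∈ Finset.Icc 1 (K p), (Psi (V / p ^ k) y : ℝ) * Real.log p := by
      intro p hp
      have hpp := prime_of_mem_primesUpTo hp
      have hp2 : (2 : ℝ) ≤ p := by exact_mod_cast hpp.two_le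
      have hp0 : (0 : ℝ) < p := by linarith
      have hlp : 0 ≤ Real.log p := Real.log_natCast_nonneg p
      set q : ℝ := (p : ℝ) ^ (-α) with hq
      have hq0 : 0 < q := by positivity
      have hq1 : q ≤ 29 / 30 := rpow_neg_prime_le hα hpp
      have hqk : ∀ k : ℕ, (V / p ^ k) ^ α = V ^ α * q ^ k := by
        intro k
        rw [Real.div_rpow hV0.le (by positivity), hq, ← Real.rpow_natCast (_ ^ (-α)),
          ← Real.rpow_mul hp0.le, ← Real.rpow_natCast p, ← Real.rpow_mul hp0.le, div_eq_mul_inv,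
          ← Real.rpow_neg hp0.le]
        congr 2
        ring
      have h1 : ∑ k ∈ Finset.Icc 1 (K p), η * (V ^ α * q ^ k + 60 * B ^ α) * Real.log p ≤
          ∑ k ∈ Finset.Icc 1 (K p), (Psi (V / p ^ k) y : ℝ) * Real.log p := by
        refine Finset.sum_le_sum fun k hk => mul_le_mul_of_nonneg_right ?_ hlp
        rw [Finset.mem_Icc] at hk
        rw [← hqk]
        have hpk0 : (0 : ℝ) < (p : ℝ) ^ k := by positivity
        have hpk2 : (2 : ℝ) ≤ (p : ℝ) ^ k :=
          hp2.trans (le_self_pow₀ (by linarith) (by omega))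
        have hpkK : (p : ℝ) ^ k ≤ V / B :=
          (pow_le_pow_right₀ (by linarith) hk.2).trans (hKle p)
        have hd2 : V / (p : ℝ) ^ k ≤ V / 2 := div_le_div_of_nonneg_left hV0.le two_pos hpk2
        refine ih _ ?_ ?_ ?_
        · rw [pow_succ] at hVn
          linarith
        · rw [le_div_iff₀ hpk0]
          rw [le_div_iff₀ hB0] at hpkK
          linarith
        · linarith
      have h2 : ∑ k ∈ Finset.Icc 1 (K p), η * (V ^ α * q ^ k + 60 * B ^ α) * Real.log p =
          η * Real.log p * (V ^ α * (q / (1 - q) - q ^ (K p + 1) / (1 - q)) +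
            60 * B ^ α * K p) := by
        rw [← sum_Icc_pow_eq (by linarith) (K p)]
        simp only [mul_add, add_mul, Finset.sum_add_distrib, Finset.mul_sum, Finset.sum_const,
          Nat.card_Icc, nsmul_eq_mul]
        congr 1
        · exact Finset.sum_congr rfl fun k _ => by ring
        · simp; ring
      have h3 : q / (1 - q) = 1 / ((p : ℝ) ^ α - 1) := by
        have hpa : (p : ℝ) ^ α = q⁻¹ := by rw [hq, Real.rpow_neg hp0.le, inv_inv]
        rw [hpa]
        have : 1 - q ≠ 0 := by linarith
        have h' : q⁻¹ - 1 ≠ 0 := by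
          have : 1 < q⁻¹ := (one_lt_inv₀ hq0).2 (by linarith)
          linarith
        field_simp
      have h4 : V ^ α * (q ^ (K p + 1) / (1 - q)) ≤ 30 * B ^ α := by
        have h5 : V ^ α * q ^ (K p + 1) ≤ B ^ α := by
          rw [← hqk]
          refine Real.rpow_le_rpow (by positivity) ?_ (by linarith)
          have := hKlt p hpp
          rw [div_lt_iff₀ hB0] at this
          rw [div_le_iff₀ (by positivity)]
          linarith
        rw [← mul_div_assoc, div_le_iff₀ (by linarith)]
        have : 0 ≤ B ^ α := by positivity
        nlinarith
      have h6 : (1 : ℝ) ≤ K p := by exact_mod_cast hK1 p hp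
      have h7 : 60 * B ^ α ≤ 60 * B ^ α * K p := le_mul_of_one_le_right (by positivity) h6
      calc _ = η * Real.log p * (V ^ α * (1 / ((p : ℝ) ^ α - 1)) + 30 * B ^ α) := by ring
        _ ≤ η * Real.log p * (V ^ α * (q / (1 - q) - q ^ (K p + 1) / (1 - q)) +
            60 * B ^ α * K p) := by
          refine mul_le_mul_of_nonneg_left ?_ (by positivity)
          rw [← h3, mul_sub]
          linarith
        _ ≤ _ := by rw [← h2]; exact h1
    have htot := Finset.sum_le_sum hterm
    rw [Finset.sum_add_distrib, ← Finset.mul_sum, ← Finset.mul_sum, hsum',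
      ← theta_eq_sum_primesUpTo] at htot
    have hlog : (Psi V y : ℝ) * Real.log V ≤ Psi V y * Real.log x :=
      mul_le_mul_of_nonneg_left (Real.log_le_log hV0 hVx) (Nat.cast_nonneg _)
    have hc : 30 * η * B ^ α * (2 * Real.log x) ≤ 30 * η * B ^ α * Chebyshev.theta y :=
      mul_le_mul_of_nonneg_left hθ (by positivity)
    have : (η * (V ^ α + 60 * B ^ α)) * Real.log x ≤ Psi V y * Real.log x := by
      linarith
    exact le_of_mul_le_mul_right this hlx

lemma sum_Psi_div_prime_le {y V : ℝ} (hy : 0 ≤ y) (hV : 1 ≤ V) {s : Finset ℕ}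
    (hs : s ⊆ primesUpTo y) (hsV : ∀ p ∈ s, (p : ℝ) ≤ V) :
    ∑ p ∈ s, (Psi (V / p) y : ℝ) * Real.log p ≤ Psi V y * Real.log V := by
  have h := sum_Psi_div_pow_le hy hV (K := fun p => if p ∈ s then 1 else 0) fun p _ => by
    split_ifs with h
    · simpa using hsV p h
    · simpa using hV
  refine le_trans ?_ h
  refine le_trans (Finset.sum_le_sum fun p hp => ?_)
    (Finset.sum_le_sum_of_subset_of_nonneg hs fun p _ _ => Finset.sum_nonneg fun k _ =>
      mul_nonneg (Nat.cast_nonneg _) (Real.log_natCast_nonneg p))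
  simp [hp]

lemma half_le_Psi {V y : ℝ} (hV : 1 ≤ V) (hVy : V ≤ y) : V / 2 ≤ Psi V y := by
  have h : countSet (IsSmooth y) ⌊V⌋₊ = Finset.Icc 1 ⌊V⌋₊ := by
    refine Finset.filter_true_of_mem fun n hn => ?_
    rw [Finset.mem_Icc] at hn
    exact isSmooth_of_le hn.1
      ((show (n : ℝ) ≤ ⌊V⌋₊ by exact_mod_cast hn.2).trans ((Nat.floor_le (by linarith)).trans hVy))
  rw [Psi_eq_card, h, Nat.card_Icc, Nat.add_sub_cancel]
  have h1 := Nat.lt_floor_add_one V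
  have h2 : (1 : ℝ) ≤ ⌊V⌋₊ := by exact_mod_cast Nat.le_floor (by simpa using hV)
  linarith

lemma exists_mul_le_Psi (k : ℕ) :
    ∃ c y₁ : ℝ, 0 < c ∧ 4 ≤ y₁ ∧ ∀ y, y₁ ≤ y → ∀ V, 1 ≤ V → V ≤ y * √y ^ k →
      c * V ≤ Psi V y := by
  obtain ⟨C, hC, hM⟩ := exists_mertens_interval
  induction k with
  | zero =>
    refine ⟨1 / 2, 4, by norm_num, le_rfl, fun y hy V hV hVy => ?_⟩
    rw [pow_zero, mul_one] at hVy
    linarith [half_le_Psi hV hVy]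
  | succ k ih =>
    obtain ⟨c, y₁, hc, hy₁, h⟩ := ih
    have hk4 : (0 : ℝ) < 4 * (k + 2) := by positivity
    refine ⟨c / (4 * (k + 2)), max y₁ (Real.exp (4 * C)), by positivity,
      hy₁.trans (le_max_left _ _), fun y hy V hV hVy => ?_⟩
    have hyy₁ := (le_max_left _ _).trans hy
    have hyC := (le_max_right _ _).trans hy
    have hy4 : 4 ≤ y := hy₁.trans hyy₁
    have hy0 : 0 < y := by linarith
    have hl : 4 * C ≤ Real.log y := (Real.le_log_iff_exp_le hy0).2 hyC
    have hs1 : 1 ≤ √y := Real.one_le_sqrt.2 (by linarith)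
    have hsq : √y * √y = y := Real.mul_self_sqrt hy0.le
    rcases le_or_gt V (y * √y ^ k) with hV1 | hV1
    · refine le_trans ?_ (h y hyy₁ V hV hV1)
      refine mul_le_mul_of_nonneg_right (div_le_self hc.le ?_) (by linarith)
      have : (0 : ℝ) ≤ k := Nat.cast_nonneg k
      linarith
    have hyV : y < V := lt_of_le_of_lt (le_mul_of_one_le_right hy0.le (one_le_pow₀ hs1)) hV1
    have hV0 : 0 < V := by linarith
    set s := (primesUpTo y).filter (fun p : ℕ => √y < p) with hs
    have hmem : ∀ p ∈ s, p.Prime ∧ (p : ℝ) ≤ y ∧ √y < p := by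
      intro p hp
      rw [hs, Finset.mem_filter, mem_primesUpTo hy0.le] at hp
      exact ⟨hp.1.1, hp.1.2, hp.2⟩
    have h1 := sum_Psi_div_prime_le (V := V) hy0.le hV (Finset.filter_subset _ _ : s ⊆ _)
      fun p hp => (hmem p hp).2.1.trans hyV.le
    have h2 : c * V * ∑ p ∈ s, Real.log p / p ≤ ∑ p ∈ s, (Psi (V / p) y : ℝ) * Real.log p := by
      rw [Finset.mul_sum]
      refine Finset.sum_le_sum fun p hp => ?_
      obtain ⟨hpp, hpy, hps⟩ := hmem p hp
      have hp0 : (0 : ℝ) < p := by exact_mod_cast hpp.pos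
      have h3 := h y hyy₁ (V / p) ((one_le_div hp0).2 (hpy.trans hyV.le)) (by
        rw [div_le_iff₀ hp0]
        calc V ≤ y * √y ^ (k + 1) := hVy
          _ = y * √y ^ k * √y := by ring
          _ ≤ _ := mul_le_mul_of_nonneg_left hps.le (by positivity))
      calc _ = c * (V / p) * Real.log p := by ring
        _ ≤ _ := mul_le_mul_of_nonneg_right h3 (Real.log_natCast_nonneg p)
    have h4 := hM (√y) y hs1 (by nlinarith)
    have h5 : Real.log (y / √y) = Real.log y / 2 := by
      rw [Real.div_sqrt, Real.log_sqrt hy0.le]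
    rw [h5] at h4
    have h6 : Real.log V ≤ (k + 2) * Real.log y := by
      have := Real.log_le_log hV0 hVy
      rw [Real.log_mul hy0.ne' (by positivity), Real.log_pow, Real.log_sqrt hy0.le] at this
      push_cast at this
      nlinarith [(Nat.cast_nonneg k : (0 : ℝ) ≤ k)]
    have hly : 0 < Real.log y := by linarith
    have h7 : c * V * (Real.log y / 4) ≤ Psi V y * ((k + 2) * Real.log y) :=
      calc _ ≤ c * V * ∑ p ∈ s, Real.log p / p :=
            mul_le_mul_of_nonneg_left (by linarith) (by positivity)
        _ ≤ Psi V y * Real.log V := h2.trans h1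
        _ ≤ _ := mul_le_mul_of_nonneg_left h6 (Nat.cast_nonneg _)
    have h8 : (c * V) * Real.log y ≤ (Psi V y * (4 * (k + 2))) * Real.log y := by linarith
    rw [div_mul_eq_mul_div, div_le_iff₀ hk4]
    exact le_of_mul_le_mul_right h8 hly

/-- A lower bound for `Ψ(V, y)` in terms of `α(x, y)`, for `V ≤ x`. -/
lemma exists_mul_rpow_le_Psi :
    ∃ c y₁ : ℝ, 0 < c ∧ 4 ≤ y₁ ∧ ∀ x y α : ℝ, y₁ ≤ y → 1 / 20 ≤ α → α ≤ 1 → alphaEq x y α →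
      2 * Real.log x ≤ Chebyshev.theta y → ∀ V r : ℝ, 1 ≤ V → V ≤ x → 1 ≤ r → V / r ≤ y ^ 2 →
        c * (V * r ^ (α - 1)) ≤ Psi V y := by
  obtain ⟨c, y₁, hc, hy₁, h⟩ := exists_mul_le_Psi 4
  refine ⟨c / 61, y₁, by positivity, hy₁, fun x y α hy hα hα1 hsum hθ V r hV hVx hr hVr => ?_⟩
  have hy4 : 4 ≤ y := hy₁.trans hy
  have hy0 : 0 < y := by linarith
  have hV0 : 0 < V := by linarith
  have hr0 : 0 < r := by linarith
  have hs4 : y * √y ^ 4 = y ^ 2 * y := by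
    have : √y ^ 4 = (√y ^ 2) ^ 2 := by ring
    rw [this, Real.sq_sqrt hy0.le]; ring
  rcases le_or_gt V (y ^ 2) with hV2 | hV2
  · refine le_trans ?_ (h y hy V hV (by rw [hs4]; nlinarith))
    have h1 : r ^ (α - 1) ≤ 1 := Real.rpow_le_one_of_one_le_of_nonpos hr (by linarith)
    have h2 : V * r ^ (α - 1) ≤ V := mul_le_of_le_one_right hV0.le h1
    calc c / 61 * (V * r ^ (α - 1)) ≤ c / 61 * V := by gcongr
      _ ≤ c * V := by nlinarith
  · have hB : (1 : ℝ) ≤ y ^ 2 := by nlinarith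
    set η := c / 61 * (y ^ 2) ^ (1 - α) with hη
    have key : ∀ W, y ^ 2 ≤ W → η * (W ^ α + 60 * (y ^ 2) ^ α) ≤ c * W := by
      intro W hW
      have hW0 : 0 < W := by linarith
      have h1 : (y ^ 2) ^ α ≤ W ^ α := Real.rpow_le_rpow (by positivity) hW (by linarith)
      have h2 : (y ^ 2) ^ (1 - α) ≤ W ^ (1 - α) :=
        Real.rpow_le_rpow (by positivity) hW (by linarith)
      calc η * (W ^ α + 60 * (y ^ 2) ^ α) ≤ (c / 61 * W ^ (1 - α)) * (61 * W ^ α) := by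
            rw [hη]
            gcongr
            linarith
        _ = c * (W ^ (1 - α) * W ^ α) := by ring
        _ = c * W := by rw [← Real.rpow_add hW0]; simp
    have h1 := Psi_ge_of_window (B := y ^ 2) (η := η) hα (by linarith) hsum hθ hB (by positivity)
      (fun W hW1 hW2 _ => (key W hW1).trans (h y hy W (by linarith) (by rwa [hs4])))
      V hV2.le hVx
    refine le_trans ?_ h1
    have h2 : V * r ^ (α - 1) ≤ (y ^ 2) ^ (1 - α) * V ^ α := by
      have h3 : (V / r) ^ (1 - α) ≤ (y ^ 2) ^ (1 - α) :=
        Real.rpow_le_rpow (by positivity) hVr (by linarith)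
      calc V * r ^ (α - 1) = (V / r) ^ (1 - α) * V ^ α := by
            rw [Real.div_rpow hV0.le hr0.le, div_mul_eq_mul_div, ← Real.rpow_add hV0,
              show α - 1 = -(1 - α) by ring, Real.rpow_neg hr0.le]
            simp [div_eq_mul_inv]
        _ ≤ _ := by gcongr
    calc c / 61 * (V * r ^ (α - 1)) ≤ c / 61 * ((y ^ 2) ^ (1 - α) * V ^ α) := by gcongr
      _ = η * V ^ α := by rw [hη]; ring
      _ ≤ _ := by
        refine mul_le_mul_of_nonneg_left ?_ (by positivity)
        have : 0 ≤ (y ^ 2) ^ α := by positivity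
        linarith

/-- A weak form of the local behaviour of `Ψ`: `Ψ(Z, y) ≪ (Z / V) ^ α Ψ(V, y) log x`. -/
lemma exists_Psi_le_mul_log :
    ∃ C : ℝ, 0 < C ∧ ∀ x y α : ℝ, 3 ≤ x → 2 ≤ y → 1 / 20 ≤ α → α ≤ 1 → alphaEq x y α →
      2 * Real.log x ≤ Chebyshev.theta y → ∀ Z V : ℝ, 1 ≤ Z → Z ≤ V → V ≤ x →
        (Psi Z y : ℝ) ≤ C * Real.log x * (Z / V) ^ α * Psi V y := by
  obtain ⟨C, hC, hM⟩ := exists_mertens_interval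
  set C₀ := Real.exp (C + 1) with hC₀
  have hC₀1 : 1 ≤ C₀ := Real.one_le_exp (by linarith)
  refine ⟨61 * C₀, by positivity, fun x y α hx hy hα hα1 hsum hθ Z V hZ hZV hVx => ?_⟩
  have hlx : 1 ≤ Real.log x := by
    rw [Real.le_log_iff_exp_le (by linarith)]
    exact Real.exp_one_lt_d9.le.trans (by linarith)
  have hZ0 : 0 < Z := by linarith
  set D := C₀ * Real.log x with hD
  have hD0 : 0 < D := by positivity
  set η := (Psi Z y : ℝ) / (Z ^ α * (61 * D)) with hη
  have hZα : 0 < Z ^ α := by positivity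
  have hwin : ∀ W, Z ≤ W → W ≤ Z * y → W ≤ x → (Psi Z y : ℝ) * (W / Z) ^ α ≤ D * Psi W y := by
    intro W hZW hWy hWx
    have hW0 : 0 < W := by linarith
    have hWZ1 : 1 ≤ W / Z := (one_le_div hZ0).2 hZW
    have hpow : (W / Z) ^ α ≤ W / Z := by
      calc (W / Z) ^ α ≤ (W / Z) ^ (1 : ℝ) := Real.rpow_le_rpow_of_exponent_le hWZ1 hα1
        _ = _ := Real.rpow_one _
    rcases le_or_gt W (C₀ * Z) with hW | hW
    · have h1 : W / Z ≤ D := by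
        rw [div_le_iff₀ hZ0]
        refine hW.trans (mul_le_mul_of_nonneg_right ?_ hZ0.le)
        exact le_mul_of_one_le_right (by linarith) hlx
      have h2 : (Psi Z y : ℝ) ≤ Psi W y := by exact_mod_cast Psi_mono hZW
      calc (Psi Z y : ℝ) * (W / Z) ^ α ≤ Psi W y * D := by gcongr; linarith
        _ = _ := mul_comm _ _
    · have hb : C₀ ≤ W / Z := by rw [le_div_iff₀ hZ0]; exact hW.le
      have hby : W / Z ≤ y := by rw [div_le_iff₀ hZ0]; linarith
      set a := W / Z / C₀ with ha
      have ha1 : 1 ≤ a := (one_le_div (by linarith)).2 hb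
      have hab : a ≤ W / Z := div_le_self (by linarith) hC₀1
      have h1 := hM a (W / Z) ha1 hab
      rw [ha, div_div_cancel₀ (by linarith), hC₀, Real.log_exp, ← hC₀, ← ha] at h1
      set s := (primesUpTo (W / Z)).filter (fun p : ℕ => a < p) with hs
      have hmem : ∀ p ∈ s, p.Prime ∧ (p : ℝ) ≤ W / Z ∧ a < p := by
        intro p hp
        rw [hs, Finset.mem_filter, mem_primesUpTo (by linarith)] at hp
        exact ⟨hp.1.1, hp.1.2, hp.2⟩
      have h2 := sum_Psi_div_prime_le (V := W) (y := y) (s := s) (by linarith) (by linarith)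
        (fun p hp => (mem_primesUpTo (by linarith)).2
          ⟨(hmem p hp).1, (hmem p hp).2.1.trans hby⟩)
        (fun p hp => (hmem p hp).2.1.trans (div_le_self hW0.le hZ))
      have h3 : Psi Z y * a * ∑ p ∈ s, Real.log p / p ≤
          ∑ p ∈ s, (Psi (W / p) y : ℝ) * Real.log p := by
        rw [Finset.mul_sum]
        refine Finset.sum_le_sum fun p hp => ?_
        obtain ⟨hpp, hpW, hap⟩ := hmem p hp
        have hp0 : (0 : ℝ) < p := by exact_mod_cast hpp.pos
        have hlp := Real.log_natCast_nonneg p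
        have h4 : (Psi Z y : ℝ) ≤ Psi (W / p) y := by
          have : Z ≤ W / p := by
            rw [le_div_iff₀ hp0]
            rw [le_div_iff₀ hZ0] at hpW
            linarith
          exact_mod_cast Psi_mono this
        have h5 : a / p ≤ 1 := (div_le_one hp0).2 hap.le
        calc _ = (Psi Z y : ℝ) * (a / p) * Real.log p := by ring
          _ ≤ Psi (W / p) y * 1 * Real.log p := by gcongr
          _ = _ := by ring
      have h6 : (Psi Z y : ℝ) * a ≤ Psi W y * Real.log x :=
        calc _ ≤ (Psi Z y : ℝ) * a * ∑ p ∈ s, Real.log p / p :=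
              le_mul_of_one_le_right (by positivity) (by linarith)
          _ ≤ Psi W y * Real.log W := h3.trans h2
          _ ≤ _ := mul_le_mul_of_nonneg_left (Real.log_le_log hW0 hWx) (Nat.cast_nonneg _)
      calc (Psi Z y : ℝ) * (W / Z) ^ α ≤ Psi Z y * (W / Z) := by gcongr
        _ = C₀ * (Psi Z y * a) := by rw [ha]; field_simp
        _ ≤ C₀ * (Psi W y * Real.log x) := by gcongr
        _ = _ := by rw [hD]; ring
  have h1 := Psi_ge_of_window (B := Z) (η := η) hα hy hsum hθ hZ (by positivity) (fun W h1 h2 h3 => by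
    have h4 := hwin W h1 h2 h3
    have h5 : Z ^ α ≤ W ^ α := Real.rpow_le_rpow hZ0.le h1 (by linarith)
    have h6 : η * (W ^ α + 60 * Z ^ α) ≤ η * (61 * W ^ α) :=
      mul_le_mul_of_nonneg_left (by linarith) (by positivity)
    refine h6.trans ?_
    have h7 : η * (61 * W ^ α) = (Psi Z y * (W / Z) ^ α) / D := by
      rw [hη, Real.div_rpow (by linarith) hZ0.le]
      field_simp
    rw [h7, div_le_iff₀ hD0]
    linarith) V hZV hVx
  have hV0 : 0 < V := by linarith
  have hVα : 0 < V ^ α := by positivity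
  have h2 : η * V ^ α ≤ Psi V y :=
    (mul_le_mul_of_nonneg_left (by linarith) (by positivity)).trans h1
  rw [hη, div_mul_eq_mul_div, div_le_iff₀ (by positivity)] at h2
  rw [Real.div_rpow hZ0.le hV0.le]
  have h3 : 61 * C₀ * Real.log x * (Z ^ α / V ^ α) * Psi V y =
      (Psi V y * (Z ^ α * (61 * D))) / V ^ α := by
    rw [hD]; ring
  rw [h3, le_div_iff₀ hVα]
  exact h2

/-- The `y`-smooth positive integers `n ≤ N` with `n ≡ c (mod r)`. -/
def smoothResidues (y : ℝ) (r c N : ℕ) : Finset ℕ :=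
  countSet (fun n => IsSmooth y n ∧ n ≡ c [MOD r]) N

lemma mem_smoothResidues {y : ℝ} {r c N n : ℕ} :
    n ∈ smoothResidues y r c N ↔ (1 ≤ n ∧ n ≤ N) ∧ IsSmooth y n ∧ n ≡ c [MOD r] :=
  mem_countSet

lemma card_smoothResidues_le (y : ℝ) {r : ℕ} (hr : 1 ≤ r) (c N : ℕ) :
    ((smoothResidues y r c N).card : ℝ) ≤ 1 + N / r := by
  have h1 : smoothResidues y r c N ⊆ (Finset.Ioc 0 N).filter (· ≡ c [MOD r]) := by
    intro n hn
    rw [mem_smoothResidues] at hn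
    rw [Finset.mem_filter, Finset.mem_Ioc]
    exact ⟨⟨hn.1.1, hn.1.2⟩, hn.2.2⟩
  have h2 := Nat.Ioc_filter_modEq_card 0 N hr c
  have h3 : (((Finset.Ioc 0 N).filter (· ≡ c [MOD r])).card : ℝ) ≤ 1 + N / r := by
    have h4 : (((Finset.Ioc 0 N).filter (· ≡ c [MOD r])).card : ℝ) =
        ((max (⌊((N : ℚ) - c) / r⌋ - ⌊(((0 : ℕ) : ℚ) - c) / r⌋) 0 : ℤ) : ℝ) := by
      exact_mod_cast congrArg (fun z : ℤ => (z : ℝ)) h2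
    rw [h4, Int.cast_max, max_le_iff]
    refine ⟨?_, by push_cast; positivity⟩
    have h5 := Int.floor_le (((N : ℚ) - c) / r)
    have h6 := Int.lt_floor_add_one ((((0 : ℕ) : ℚ) - c) / r)
    have h7 : ((⌊((N : ℚ) - c) / r⌋ - ⌊(((0 : ℕ) : ℚ) - c) / r⌋ : ℤ) : ℚ) ≤ 1 + N / r := by
      push_cast at *
      have : ((N : ℚ) - c) / r = N / r + (0 - c) / r := by ring
      linarith
    generalize ⌊((N : ℚ) - c) / r⌋ - ⌊(((0 : ℕ) : ℚ) - c) / r⌋ = z at h7 ⊢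
    have h8 : (((z : ℚ)) : ℝ) ≤ ((1 + (N : ℚ) / r : ℚ) : ℝ) := Rat.cast_le.2 h7
    push_cast at h8
    exact h8
  exact le_trans (by exact_mod_cast Finset.card_le_card h1) h3

lemma exists_card_filter_pow_dvd_le {y : ℝ} {r c p : ℕ} (hp : p.Prime) (k N : ℕ)
    (hpr : p.Coprime r) (hc : c.Coprime r) :
    ∃ c' : ℕ, c'.Coprime r ∧ ((smoothResidues y r c N).filter (fun n => p ^ k ∣ n)).card ≤
      (smoothResidues y r c' (N / p ^ k)).card := by
  rcases Finset.eq_empty_or_nonempty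
    ((smoothResidues y r c N).filter (fun n => p ^ k ∣ n)) with h | ⟨n₀, h⟩
  · exact ⟨c, hc, by rw [h]; simp⟩
  rw [Finset.mem_filter, mem_smoothResidues] at h
  obtain ⟨⟨-, -, hn₀⟩, m₀, rfl⟩ := h
  have hpk : 0 < p ^ k := Nat.pow_pos hp.pos
  refine ⟨m₀, ?_, Finset.card_le_card_of_injOn (fun n => n / p ^ k) ?_ ?_⟩
  · have h1 : (p ^ k * m₀).Coprime r := by
      rw [Nat.Coprime, hn₀.gcd_eq]
      exact hc
    exact Nat.Coprime.coprime_mul_left h1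
  · intro n hn
    rw [Finset.mem_coe, Finset.mem_filter, mem_smoothResidues] at hn
    obtain ⟨⟨⟨hn1, hnN⟩, hns, hnc⟩, m, rfl⟩ := hn
    rw [Finset.mem_coe, mem_smoothResidues]
    simp only [Nat.mul_div_cancel_left _ hpk]
    refine ⟨⟨Nat.pos_of_mul_pos_left hn1, ?_⟩, hns.of_dvd (dvd_mul_left _ _), ?_⟩
    · rw [Nat.le_div_iff_mul_le hpk, mul_comm]
      exact hnN
    · exact Nat.ModEq.cancel_left_of_coprime
        (by rw [← Nat.coprime_iff_gcd_eq_one]; exact (hpr.pow_left k).symm) (hnc.trans hn₀.symm)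
  · intro a ha b hb hab
    rw [Finset.mem_coe, Finset.mem_filter] at ha hb
    exact Nat.div_left_inj ha.2 hb.2 |>.1 hab

lemma card_filter_pow_dvd_eq_zero {y : ℝ} {r c p k : ℕ} (hp : p.Prime) (hk : 1 ≤ k) (N : ℕ)
    (hpr : p ∣ r) (hc : c.Coprime r) :
    ((smoothResidues y r c N).filter (fun n => p ^ k ∣ n)).card = 0 := by
  rw [Finset.card_eq_zero, Finset.filter_eq_empty_iff]
  intro n hn hpn
  rw [mem_smoothResidues] at hn
  have h1 : n.Coprime r := by
    rw [Nat.Coprime, hn.2.2.gcd_eq]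
    exact hc
  exact hp.one_lt.ne' (Nat.eq_one_of_dvd_coprimes h1 ((dvd_pow_self p (by omega)).trans hpn) hpr)

lemma sum_div_pow_le {p : ℕ} (hp : 2 ≤ p) {B : ℝ} (hB : 0 ≤ B) (M N : ℕ) :
    ∑ k ∈ Finset.range M, (if ((N / p ^ k : ℕ) : ℝ) < B then ((N / p ^ k : ℕ) : ℝ) else 0) ≤ 2 * B ∧
    ∑ k ∈ Finset.range M, (if ((N / p ^ k : ℕ) : ℝ) < B then ((N / p ^ k : ℕ) : ℝ) else 0) ≤
      2 * N := by
  induction M generalizing N with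
  | zero => simp [hB]
  | succ M ih =>
    rw [Finset.sum_range_succ']
    simp only [pow_succ', ← Nat.div_div_eq_div_mul, pow_zero, Nat.div_one]
    obtain ⟨h1, h2⟩ := ih (N / p)
    have h3 : 2 * ((N / p : ℕ) : ℝ) ≤ N := by
      have : (N / p) * p ≤ N := Nat.div_mul_le_self N p
      have h4 : 2 * (N / p) ≤ N := by nlinarith
      exact_mod_cast h4
    split_ifs with h
    · constructor <;> linarith
    · have : (0 : ℝ) ≤ N := Nat.cast_nonneg N
      constructor <;> linarith

lemma sum_log_of_pow_le {p N : ℕ} (hp : p.Prime) (hN : 1 ≤ N) (M : ℕ) :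
    ∑ k ∈ Finset.Icc 1 M, (if p ^ k ≤ N then Real.log p else 0) ≤ Real.log N := by
  rw [← Finset.sum_filter, Finset.sum_const, nsmul_eq_mul]
  have h1 : ((Finset.Icc 1 M).filter (fun k => p ^ k ≤ N)).card ≤ Nat.log p N := by
    have : (Finset.Icc 1 M).filter (fun k => p ^ k ≤ N) ⊆ Finset.Icc 1 (Nat.log p N) := by
      intro k hk
      rw [Finset.mem_filter, Finset.mem_Icc] at hk
      rw [Finset.mem_Icc]
      exact ⟨hk.1.1, Nat.le_log_of_pow_le hp.one_lt hk.2⟩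
    simpa using Finset.card_le_card this
  have h2 : p ^ Nat.log p N ≤ N := Nat.pow_log_le_self p (by omega)
  calc _ ≤ (Nat.log p N : ℝ) * Real.log p := by
        gcongr
    _ = Real.log ((p ^ Nat.log p N : ℕ) : ℝ) := by push_cast; rw [Real.log_pow]
    _ ≤ _ := Real.log_le_log (by exact_mod_cast Nat.pow_pos hp.pos) (by exact_mod_cast h2)

lemma theta_sub_log_le {y : ℝ} {r : ℕ} (hr : 1 ≤ r) :
    Chebyshev.theta y - Real.log r ≤
      ∑ p ∈ primesUpTo y, if p ∣ r then 0 else Real.log p := by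
  have h1 : ∑ p ∈ primesUpTo y, (if p ∣ r then Real.log p else 0) ≤ Real.log r := by
    rw [← Finset.sum_filter]
    have h2 : (primesUpTo y).filter (· ∣ r) ⊆ r.primeFactors := by
      intro p hp
      rw [Finset.mem_filter] at hp
      exact Nat.mem_primeFactors.2 ⟨prime_of_mem_primesUpTo hp.1, hp.2, by omega⟩
    refine (Finset.sum_le_sum_of_subset_of_nonneg h2 fun p _ _ =>
      Real.log_natCast_nonneg p).trans ?_
    rw [← Real.log_prod fun p hp => by
      have := (Nat.prime_of_mem_primeFactors hp).pos
      positivity]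
    have h3 := Nat.le_of_dvd hr (Nat.prod_primeFactors_dvd r)
    rw [← Nat.cast_prod]
    refine Real.log_le_log ?_ (by exact_mod_cast h3)
    rw [Nat.cast_prod]
    refine Finset.prod_pos fun p hp => ?_
    exact_mod_cast (Nat.prime_of_mem_primeFactors hp).pos
  have h2 : Chebyshev.theta y = ∑ p ∈ primesUpTo y, (if p ∣ r then Real.log p else 0) +
      ∑ p ∈ primesUpTo y, if p ∣ r then 0 else Real.log p := by
    rw [theta_eq_sum_primesUpTo, ← Finset.sum_add_distrib]
    exact Finset.sum_congr rfl fun p _ => by split_ifs <;> simp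
  linarith

lemma log_succ_sub_log_nonneg (m : ℕ) : 0 ≤ Real.log ((m : ℝ) + 1) - Real.log m := by
  rcases Nat.eq_zero_or_pos m with rfl | hm
  · simp
  · rw [sub_nonneg]
    exact Real.log_le_log (by exact_mod_cast hm) (by linarith)

lemma mul_log_succ_sub_log_le (m : ℕ) : (m : ℝ) * (Real.log ((m : ℝ) + 1) - Real.log m) ≤ 1 := by
  rcases Nat.eq_zero_or_pos m with rfl | hm
  · simp
  · have hm0 : (0 : ℝ) < m := by exact_mod_cast hm
    rw [← Real.log_div (by positivity) hm0.ne', ← le_div_iff₀' hm0]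
    refine (Real.log_le_sub_one_of_pos (by positivity)).trans (le_of_eq ?_)
    field_simp
    ring

lemma sum_log_succ_sub_log_mul_le {r N : ℕ} (hr : 1 ≤ r) {y : ℝ} (hy : 0 ≤ y) :
    ∑ m ∈ Finset.range N, (if (m : ℝ) < r * y then 1 + (m : ℝ) / r else 0) *
      (Real.log (m + 1) - Real.log m) ≤ Real.log N + (y + 1) := by
  have hr0 : (0 : ℝ) < r := by exact_mod_cast hr
  have h1 : ∑ m ∈ Finset.range N, (Real.log ((m : ℝ) + 1) - Real.log m) = Real.log N := by
    have := Finset.sum_range_sub (fun m : ℕ => Real.log m) N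
    push_cast at this
    rw [this]; simp
  have h2 : ∑ m ∈ Finset.range N, (if (m : ℝ) < r * y then (1 : ℝ) / r else 0) ≤ y + 1 := by
    rw [← Finset.sum_filter, Finset.sum_const, nsmul_eq_mul]
    have h3 : (Finset.range N).filter (fun m : ℕ => (m : ℝ) < r * y) ⊆
        Finset.range (⌊(r : ℝ) * y⌋₊ + 1) := by
      intro m hm
      rw [Finset.mem_filter] at hm
      rw [Finset.mem_range, Nat.lt_succ_iff]
      exact Nat.le_floor hm.2.le
    have h4 : (((Finset.range N).filter (fun m : ℕ => (m : ℝ) < r * y)).card : ℝ) ≤ r * y + 1 := by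
      have := Finset.card_le_card h3
      rw [Finset.card_range] at this
      have h5 := Nat.floor_le (show 0 ≤ (r : ℝ) * y by positivity)
      have h6 : (((Finset.range N).filter (fun m : ℕ => (m : ℝ) < r * y)).card : ℝ) ≤
        ⌊(r : ℝ) * y⌋₊ + 1 := by exact_mod_cast this
      linarith
    rw [mul_one_div, div_le_iff₀ hr0]
    have : (1 : ℝ) ≤ r := by exact_mod_cast hr
    nlinarith
  calc _ ≤ ∑ m ∈ Finset.range N, ((Real.log ((m : ℝ) + 1) - Real.log m) +
        if (m : ℝ) < r * y then (1 : ℝ) / r else 0) := by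
        refine Finset.sum_le_sum fun m _ => ?_
        have h3 := log_succ_sub_log_nonneg m
        have h4 := mul_log_succ_sub_log_le m
        split_ifs with h
        · have : (1 + (m : ℝ) / r) * (Real.log (m + 1) - Real.log m) =
            (Real.log (m + 1) - Real.log m) + m * (Real.log (m + 1) - Real.log m) / r := by ring
          rw [this]
          gcongr
        · linarith
    _ ≤ _ := by rw [Finset.sum_add_distrib, h1]; linarith

lemma Psi_div_pow_natCast (N p k : ℕ) (y : ℝ) :
    Psi ((N : ℝ) / p ^ k) y = Psi ((N / p ^ k : ℕ) : ℝ) y := by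
  have e : ⌊(N : ℝ) / (p : ℝ) ^ k⌋₊ = N / p ^ k := by
    have := Nat.floor_div_eq_div (K := ℝ) N (p ^ k)
    exact_mod_cast this
  rw [Psi_eq_card, Psi_eq_card, e, Nat.floor_natCast]

lemma sum_card_filter_pow_dvd_le {y ρ D : ℝ} {r c p N : ℕ} (hy : 1 ≤ y) (hρ : 0 ≤ ρ) (hD : 0 ≤ D)
    (hr : 1 ≤ r) (hc : c.Coprime r) (hp : p.Prime) (hN : 1 ≤ N)
    (hNp : r * y ≤ ((N / p : ℕ) : ℝ))
    (ih : ∀ m < N, r * y ≤ (m : ℝ) → ∀ c : ℕ, c.Coprime r →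
      ((smoothResidues y r c m).card : ℝ) ≤ ρ * Psi m y - D) :
    ∑ k ∈ Finset.Icc 1 N,
      (((smoothResidues y r c N).filter (fun n => p ^ k ∣ n)).card : ℝ) * Real.log p ≤
    ρ * ∑ k ∈ Finset.Icc 1 N, (Psi ((N : ℝ) / p ^ k) y : ℝ) * Real.log p +
      (Real.log N + 2 * y * Real.log p) - D * (if p ∣ r then 0 else Real.log p) := by
  have hlp : 0 ≤ Real.log p := Real.log_natCast_nonneg p
  have hlN : 0 ≤ Real.log N := Real.log_natCast_nonneg N
  have hr0 : (0 : ℝ) < r := by exact_mod_cast hr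
  split_ifs with hpr
  · rw [Finset.sum_eq_zero fun k hk => by
      rw [card_filter_pow_dvd_eq_zero hp (Finset.mem_Icc.1 hk).1 N hpr hc]; simp]
    rw [mul_zero, sub_zero]
    have : 0 ≤ ∑ k ∈ Finset.Icc 1 N, (Psi ((N : ℝ) / p ^ k) y : ℝ) * Real.log p :=
      Finset.sum_nonneg fun k _ => by positivity
    positivity
  · have hpc : p.Coprime r := (Nat.Prime.coprime_iff_not_dvd hp).2 hpr
    set B : ℝ := r * y with hB
    have hB0 : 0 < B := by positivity
    have key : ∀ k ∈ Finset.Icc 1 N,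
        (((smoothResidues y r c N).filter (fun n => p ^ k ∣ n)).card : ℝ) * Real.log p ≤
        ρ * ((Psi ((N : ℝ) / p ^ k) y : ℝ) * Real.log p) + (if p ^ k ≤ N then Real.log p else 0) +
        (if ((N / p ^ k : ℕ) : ℝ) < B then ((N / p ^ k : ℕ) : ℝ) else 0) * (Real.log p / r) -
        (if k = 1 then D * Real.log p else 0) := by
      intro k hk
      obtain ⟨c', hc', hle⟩ := exists_card_filter_pow_dvd_le (y := y) (c := c) hp k N hpc hc
      have hle' : (((smoothResidues y r c N).filter (fun n => p ^ k ∣ n)).card : ℝ) ≤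
        (smoothResidues y r c' (N / p ^ k)).card := by exact_mod_cast hle
      rw [Psi_div_pow_natCast]
      have hk1 := (Finset.mem_Icc.1 hk).1
      have hif : 0 ≤ if p ^ k ≤ N then Real.log p else 0 := by split_ifs <;> positivity
      rcases lt_or_ge ((N / p ^ k : ℕ) : ℝ) B with hlt | hge
      · have hkne : k ≠ 1 := by
          rintro rfl
          rw [pow_one] at hlt
          linarith
        rw [if_pos hlt, if_neg hkne, sub_zero]
        have h1 : 0 ≤ ρ * ((Psi ((N / p ^ k : ℕ) : ℝ) y : ℝ) * Real.log p) := by positivity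
        rcases le_or_gt (p ^ k) N with h2 | h2
        · rw [if_pos h2]
          have h3 := hle'.trans (card_smoothResidues_le y hr c' (N / p ^ k))
          have h4 := mul_le_mul_of_nonneg_right h3 hlp
          have h5 : (1 + ((N / p ^ k : ℕ) : ℝ) / r) * Real.log p =
            Real.log p + ((N / p ^ k : ℕ) : ℝ) * (Real.log p / r) := by ring
          linarith
        · have h3 : N / p ^ k = 0 := Nat.div_eq_of_lt h2
          have h4 : (smoothResidues y r c' 0).card = 0 := by simp [smoothResidues, countSet]
          rw [h3, h4] at hle
          rw [Nat.le_zero.1 hle]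
          have : 0 ≤ ((N / p ^ k : ℕ) : ℝ) * (Real.log p / r) := by positivity
          push_cast
          linarith
      · rw [if_neg (not_lt.2 hge)]
        have h1 := ih (N / p ^ k) (Nat.div_lt_self hN (Nat.one_lt_pow (by omega) hp.one_lt))
          hge c' hc'
        have h2 := mul_le_mul_of_nonneg_right (hle'.trans h1) hlp
        have h3 : 0 ≤ D * Real.log p := by positivity
        split_ifs at hif ⊢ <;> linarith
    refine (Finset.sum_le_sum key).trans ?_
    rw [Finset.sum_sub_distrib, Finset.sum_add_distrib, Finset.sum_add_distrib, ← Finset.mul_sum,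
      ← Finset.sum_mul, Finset.sum_ite_eq', if_pos (Finset.mem_Icc.2 ⟨le_rfl, hN⟩)]
    have h1 := sum_log_of_pow_le hp hN N
    have h2 := (sum_div_pow_le hp.two_le hB0.le (N + 1) N).1
    have h3 : ∑ k ∈ Finset.Icc 1 N, (if ((N / p ^ k : ℕ) : ℝ) < B then ((N / p ^ k : ℕ) : ℝ) else 0)
        ≤ 2 * B := by
      refine le_trans (Finset.sum_le_sum_of_subset_of_nonneg ?_ fun k _ _ => ?_) h2
      · intro k hk
        rw [Finset.mem_Icc] at hk
        exact Finset.mem_range.2 (by omega)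
      · split_ifs <;> positivity
    have h4 := mul_le_mul_of_nonneg_right h3 (show 0 ≤ Real.log p / r by positivity)
    have h5 : 2 * B * (Real.log p / r) = 2 * y * Real.log p := by
      rw [hB]; field_simp
    rw [Finset.sum_mul] at h4
    linarith

lemma card_smoothResidues_mul_log_le {x y ρ : ℝ} {r c N : ℕ} (hy : 4 ≤ y) (hx : 3 ≤ x)
    (hρ : 0 ≤ ρ) (hr : 1 ≤ r) (hc : c.Coprime r) (hθ : 4 * Real.log x ≤ Chebyshev.theta y)
    (hN : 2 * (r * y ^ 2) < N) (hNx : N ≤ x)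
    (ih : ∀ m < N, r * y ≤ (m : ℝ) → ∀ c : ℕ, c.Coprime r →
      ((smoothResidues y r c m).card : ℝ) ≤ ρ * Psi m y - 6 * y) :
    ((smoothResidues y r c N).card : ℝ) * Real.log N ≤ (ρ * Psi N y - 6 * y) * Real.log N := by
  have hy0 : 0 < y := by linarith
  have hr1 : (1 : ℝ) ≤ r := by exact_mod_cast hr
  have hr0 : (0 : ℝ) < r := by linarith
  have hrN : (r : ℝ) < N := by
    have : (r : ℝ) * 1 ≤ r * y ^ 2 := by gcongr; nlinarith
    linarith
  have hN1 : 1 ≤ N := by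
    have : (1 : ℝ) ≤ N := by linarith
    exact_mod_cast this
  have hN0 : (0 : ℝ) < N := by linarith
  have hlN : Real.log N ≤ Real.log x := Real.log_le_log hN0 hNx
  have hlr : Real.log r ≤ Real.log x := Real.log_le_log hr0 (by linarith)
  have hlx : 1 ≤ Real.log x := by
    rw [Real.le_log_iff_exp_le (by linarith)]
    exact Real.exp_one_lt_d9.le.trans (by linarith)
  have hlN0 : 0 ≤ Real.log N := Real.log_natCast_nonneg N
  have hA : ∑ m ∈ Finset.range N, ((smoothResidues y r c m).card : ℝ) *
      (Real.log (m + 1) - Real.log m) ≤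
      ρ * ∑ m ∈ Finset.range N, (Psi m y : ℝ) * (Real.log (m + 1) - Real.log m) +
        (Real.log N + (y + 1)) := by
    refine le_trans ?_ (add_le_add_right (sum_log_succ_sub_log_mul_le hr hy0.le) _)
    rw [Finset.mul_sum, ← Finset.sum_add_distrib]
    refine Finset.sum_le_sum fun m hm => ?_
    rw [← mul_assoc, ← add_mul]
    refine mul_le_mul_of_nonneg_right ?_ (log_succ_sub_log_nonneg m)
    have h1 : 0 ≤ ρ * Psi m y := by positivity
    split_ifs with h
    · linarith [card_smoothResidues_le y hr c m]
    · linarith [ih m (Finset.mem_range.1 hm) (not_lt.1 h) c hc]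
  have hB : ∑ p ∈ primesUpTo y, ∑ k ∈ Finset.Icc 1 N,
      (((smoothResidues y r c N).filter (fun n => p ^ k ∣ n)).card : ℝ) * Real.log p ≤
      ρ * ∑ p ∈ primesUpTo y, ∑ k ∈ Finset.Icc 1 N, (Psi ((N : ℝ) / p ^ k) y : ℝ) * Real.log p +
      (y * Real.log N + 2 * y * Chebyshev.theta y) -
      6 * y * (Chebyshev.theta y - Real.log r) := by
    have h1 : ∀ p ∈ primesUpTo y, _ := fun p hp =>
      sum_card_filter_pow_dvd_le (D := 6 * y) (by linarith) hρ (by positivity) hr hc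
        (prime_of_mem_primesUpTo hp) hN1 (by
          have hpp := prime_of_mem_primesUpTo hp
          have hpy := ((mem_primesUpTo hy0.le).1 hp).2
          have hp0 : (0 : ℝ) < p := by exact_mod_cast hpp.pos
          have h2 : (N : ℝ) < (((N / p : ℕ) : ℝ) + 1) * p := by
            exact_mod_cast Nat.lt_mul_of_div_lt (Nat.lt_succ_self (N / p)) hpp.pos
          have h3 : (((N / p : ℕ) : ℝ) + 1) * p ≤ (((N / p : ℕ) : ℝ) + 1) * y := by gcongr
          have h4 : (2 * (r * y)) * y < (((N / p : ℕ) : ℝ) + 1) * y := by nlinarith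
          have h5 := lt_of_mul_lt_mul_right h4 hy0.le
          nlinarith) ih
    refine (Finset.sum_le_sum h1).trans ?_
    rw [Finset.sum_sub_distrib, Finset.sum_add_distrib, Finset.sum_add_distrib, ← Finset.mul_sum,
      ← Finset.mul_sum, ← Finset.mul_sum, ← theta_eq_sum_primesUpTo, Finset.sum_const,
      nsmul_eq_mul]
    have h2 := mul_le_mul_of_nonneg_left (theta_sub_log_le (y := y) hr)
      (show 0 ≤ 6 * y by positivity)
    have h3 : ((primesUpTo y).card : ℝ) ≤ y := by
      refine le_trans ?_ (Nat.floor_le hy0.le)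
      have : primesUpTo y ⊆ Finset.Icc 1 ⌊y⌋₊ := by
        intro p hp
        have h4 := (mem_primesUpTo hy0.le).1 hp
        exact Finset.mem_Icc.2 ⟨h4.1.pos, Nat.le_floor h4.2⟩
      have h5 := Finset.card_le_card this
      rw [Nat.card_Icc, Nat.add_sub_cancel] at h5
      exact_mod_cast h5
    have h4 := mul_le_mul_of_nonneg_right h3 hlN0
    linarith
  have hC := sum_Psi_le hy0.le N
  have hD := mul_le_mul_of_nonneg_left hC hρ
  have e : ((smoothResidues y r c N).card : ℝ) * Real.log N =
      ∑ m ∈ Finset.range N, ((smoothResidues y r c m).card : ℝ) *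
      (Real.log (m + 1) - Real.log m) + ∑ p ∈ primesUpTo y, ∑ k ∈ Finset.Icc 1 N,
      (((smoothResidues y r c N).filter (fun n => p ^ k ∣ n)).card : ℝ) * Real.log p := by
    rw [smoothResidues, card_countSet_mul_log, sum_log_countSet hy0.le (fun _ h => h.1)]
    rfl
  rw [e]
  set θ := Chebyshev.theta y
  have e1 : Real.log N ≤ θ / 4 := by linarith
  have e2 : y * Real.log N ≤ y * (θ / 4) := by gcongr
  have e3 : y * Real.log r ≤ y * (θ / 4) := by gcongr; linarith
  have e4 : 4 * y ≤ y * θ := by nlinarith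
  have e5 : 4 * θ ≤ y * θ := by nlinarith
  linarith

lemma exists_card_smoothResidues_coprime_le :
    ∃ C y₁ : ℝ, 0 < C ∧ 4 ≤ y₁ ∧ ∀ x y α : ℝ, y₁ ≤ y → 3 ≤ x → 1 / 20 ≤ α → α ≤ 1 →
      alphaEq x y α → 4 * Real.log x ≤ Chebyshev.theta y → ∀ r N : ℕ, 1 ≤ r → r * y ≤ N → N ≤ x →
        ∀ c : ℕ, c.Coprime r →
          ((smoothResidues y r c N).card : ℝ) ≤ C * (r : ℝ) ^ (-α) * Psi N y := by
  obtain ⟨c₁, y₁, hc₁, hy₁, h⟩ := exists_mul_rpow_le_Psi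
  refine ⟨16 / c₁, y₁, by positivity, hy₁, fun x y α hy hx hα hα1 hsum hθ r N hr => ?_⟩
  have hy4 : 4 ≤ y := hy₁.trans hy
  have hr1 : (1 : ℝ) ≤ r := by exact_mod_cast hr
  have hr0 : (0 : ℝ) < r := by linarith
  have hlx : 0 ≤ Real.log x := Real.log_nonneg (by linarith)
  set ρ := 16 / c₁ * (r : ℝ) ^ (-α) with hρ
  have hρ0 : 0 ≤ ρ := by positivity
  suffices key : r * y ≤ (N : ℝ) → N ≤ x → ∀ c : ℕ, c.Coprime r →
      ((smoothResidues y r c N).card : ℝ) ≤ ρ * Psi N y - 6 * y from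
    fun h1 h2 c hc => (key h1 h2 c hc).trans (by linarith)
  induction N using Nat.strong_induction_on with
  | _ N ih =>
    intro hN hNx c hc
    have hN4 : (4 : ℝ) ≤ N := by nlinarith
    rcases le_or_gt (N : ℝ) (2 * (r * y ^ 2)) with hsmall | hbig
    · have h1 := h x y α hy hα hα1 hsum (by linarith) N (2 * r) (by linarith) hNx (by linarith)
        (by rw [div_le_iff₀ (by positivity)]; linarith)
      have h2 : (r : ℝ) ^ (-α) * (2 * r) ^ (α - 1) ≥ (2 * (r : ℝ))⁻¹ := by
        have h3 : (2 * (r : ℝ)) ^ (-α) ≤ (r : ℝ) ^ (-α) :=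
          Real.rpow_le_rpow_of_nonpos hr0 (by linarith) (by linarith)
        calc (2 * (r : ℝ))⁻¹ = (2 * r) ^ (-α) * (2 * r) ^ (α - 1) := by
              rw [← Real.rpow_add (by positivity), show -α + (α - 1) = -1 by ring,
                Real.rpow_neg_one]
          _ ≤ _ := by gcongr
      have h4 : 8 * (N / r : ℝ) ≤ ρ * Psi N y :=
        calc 8 * (N / r : ℝ) = 16 / c₁ * (c₁ * (N * (2 * (r : ℝ))⁻¹)) := by field_simp; norm_num
          _ ≤ 16 / c₁ * (c₁ * (N * ((r : ℝ) ^ (-α) * (2 * r) ^ (α - 1)))) := by gcongr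
          _ = ρ * (c₁ * (N * (2 * r) ^ (α - 1))) := by rw [hρ]; ring
          _ ≤ _ := by gcongr
      have h5 : y ≤ N / r := by rw [le_div_iff₀ hr0]; linarith
      have h6 := card_smoothResidues_le y hr c N
      linarith
    · have h1 := card_smoothResidues_mul_log_le hy4 hx hρ0 hr hc hθ hbig hNx
        fun m hm hrm c hc => ih m hm hrm (le_trans (by exact_mod_cast hm.le) hNx) c hc
      exact le_of_mul_le_mul_right h1 (Real.log_pos (by linarith))

lemma one_le_log_of_three_le {x : ℝ} (hx : 3 ≤ x) : 1 ≤ Real.log x := by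
  rw [Real.le_log_iff_exp_le (by linarith)]
  exact Real.exp_one_lt_d9.le.trans (by linarith)

lemma log_le_rpow_of_log_rpow_le {x y : ℝ} (hx : 3 ≤ x) (h : Real.log x ^ (1.1 : ℝ) ≤ y) :
    Real.log x ≤ y ^ (10 / 11 : ℝ) := by
  have hl : 0 ≤ Real.log x := by linarith [one_le_log_of_three_le hx]
  have h1 := Real.rpow_le_rpow (by positivity) h (show (0 : ℝ) ≤ 10 / 11 by norm_num)
  rwa [← Real.rpow_mul hl, show (1.1 : ℝ) * (10 / 11) = 1 by norm_num, Real.rpow_one] at h1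

lemma alphaEq_le_one {x y α : ℝ} (hx : 3 ≤ x) (hy : 16 < y) (hyx : y ≤ x ^ ((1 : ℝ) / 3))
    (h : alphaEq x y α) : α ≤ 1 := by
  by_contra! hα
  have hy0 : 0 < y := by linarith
  have hN : 1 ≤ ⌊y⌋₊ := Nat.le_floor (by push_cast; linarith)
  have h1 := sum_log_div_prime_le hN
  rw [primesUpTo_floor] at h1
  have h2 : Real.log ⌊y⌋₊ ≤ Real.log y :=
    Real.log_le_log (by exact_mod_cast hN) (Nat.floor_le hy0.le)
  have h3 : Real.log x ≤ 2 * ∑ p ∈ primesUpTo y, Real.log p / p := by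
    rw [← h, Finset.mul_sum]
    refine Finset.sum_le_sum fun p hp => ?_
    have hpp := prime_of_mem_primesUpTo hp
    have hp2 : (2 : ℝ) ≤ p := by exact_mod_cast hpp.two_le
    have h4 : (p : ℝ) ≤ (p : ℝ) ^ α := by
      calc (p : ℝ) = (p : ℝ) ^ (1 : ℝ) := (Real.rpow_one _).symm
        _ ≤ _ := Real.rpow_le_rpow_of_exponent_le (by linarith) hα.le
    calc Real.log p / ((p : ℝ) ^ α - 1) ≤ Real.log p / (p / 2) := by
          refine div_le_div_of_nonneg_left (Real.log_natCast_nonneg p) (by linarith) (by linarith)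
      _ = _ := by field_simp
  have h4 : Real.log y ≤ 1 / 3 * Real.log x := by
    rw [← Real.log_rpow (by linarith)]
    exact Real.log_le_log hy0 hyx
  have h5 : 2 * Real.log 4 < Real.log y := by
    rw [← Real.log_rpow (by norm_num)]
    exact Real.log_lt_log (by norm_num) (by norm_num; linarith)
  linarith

lemma le_alphaEq {x y α : ℝ} (hx : 3 ≤ x) (hy : 1 ≤ y) (h : alphaEq x y α)
    (hθ : Real.log x * y ^ (1 / 20 : ℝ) < Chebyshev.theta y) : 1 / 20 ≤ α := by
  by_contra! hα
  have hl := one_le_log_of_three_le hx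
  rcases le_or_gt α 0 with h0 | h0
  · have h1 : Real.log x ≤ 0 := by
      rw [← h]
      refine Finset.sum_nonpos fun p hp => ?_
      have hpp := prime_of_mem_primesUpTo hp
      have hp2 : (2 : ℝ) ≤ p := by exact_mod_cast hpp.two_le
      refine div_nonpos_of_nonneg_of_nonpos (Real.log_natCast_nonneg p) ?_
      linarith [Real.rpow_le_one_of_one_le_of_nonpos (show (1 : ℝ) ≤ p by linarith) h0]
    linarith
  · have h1 : Chebyshev.theta y / y ^ (1 / 20 : ℝ) ≤ Real.log x := by
      rw [← h, theta_eq_sum_primesUpTo, Finset.sum_div]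
      refine Finset.sum_le_sum fun p hp => ?_
      have hpp := prime_of_mem_primesUpTo hp
      have hp1 : (1 : ℝ) < p := by exact_mod_cast hpp.one_lt
      have hpy := ((mem_primesUpTo (by linarith)).1 hp).2
      have h2 : 1 < (p : ℝ) ^ α := Real.one_lt_rpow hp1 h0
      have h3 : (p : ℝ) ^ α ≤ y ^ (1 / 20 : ℝ) :=
        (Real.rpow_le_rpow (by linarith) hpy h0.le).trans
          (Real.rpow_le_rpow_of_exponent_le hy hα.le)
      exact div_le_div_of_nonneg_left (Real.log_natCast_nonneg p) (by linarith) (by linarith)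
    rw [div_le_iff₀ (by positivity)] at h1
    linarith

lemma exists_alphaEq_bounds :
    ∃ y₀ : ℝ, 4 ≤ y₀ ∧ ∀ x y α : ℝ, y₀ ≤ y → 3 ≤ x → Real.log x ^ (1.1 : ℝ) ≤ y →
      y ≤ x ^ ((1 : ℝ) / 3) → alphaEq x y α →
        4 * Real.log x ≤ Chebyshev.theta y ∧ 1 / 20 ≤ α ∧ α ≤ 1 := by
  obtain ⟨c, y₁, hc, hy₁, h⟩ := exists_mul_le_theta
  refine ⟨max 17 (max y₁ ((4 / c) ^ (220 / 9 : ℝ))),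
    le_trans (by norm_num) (le_max_left _ _), fun x y α hy hx hxy hyx hα => ?_⟩
  have hy17 := (le_max_left _ _).trans hy
  have hyy₁ := ((le_max_left _ _).trans (le_max_right _ _)).trans hy
  have hyc := ((le_max_right _ _).trans (le_max_right _ _)).trans hy
  have hy0 : 0 < y := by linarith
  have hl := one_le_log_of_three_le hx
  have h1 := log_le_rpow_of_log_rpow_le hx hxy
  have h2 : 4 / c ≤ y ^ (9 / 220 : ℝ) := by
    have := Real.rpow_le_rpow (by positivity) hyc (show (0 : ℝ) ≤ 9 / 220 by norm_num)
    rwa [← Real.rpow_mul (by positivity), show (220 / 9 : ℝ) * (9 / 220) = 1 by norm_num,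
      Real.rpow_one] at this
  have h3 : 4 * Real.log x * y ^ (1 / 20 : ℝ) ≤ Chebyshev.theta y := by
    refine le_trans ?_ (h y hyy₁)
    rw [div_le_iff₀ hc] at h2
    calc 4 * Real.log x * y ^ (1 / 20 : ℝ) ≤
          (y ^ (9 / 220 : ℝ) * c) * y ^ (10 / 11 : ℝ) * y ^ (1 / 20 : ℝ) := by gcongr
      _ = c * (y ^ (9 / 220 : ℝ) * y ^ (10 / 11 : ℝ) * y ^ (1 / 20 : ℝ)) := by ring
      _ = c * y := by
        rw [← Real.rpow_add hy0, ← Real.rpow_add hy0,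
          show (9 / 220 : ℝ) + 10 / 11 + 1 / 20 = 1 by norm_num, Real.rpow_one]
  have h4 : 1 ≤ y ^ (1 / 20 : ℝ) := Real.one_le_rpow (by linarith) (by norm_num)
  refine ⟨le_trans (le_mul_of_one_le_right (by linarith) h4) h3, ?_,
    alphaEq_le_one hx (by linarith) hyx hα⟩
  refine le_alphaEq hx (by linarith) hα (lt_of_lt_of_le ?_ h3)
  have : 0 < Real.log x * y ^ (1 / 20 : ℝ) := by positivity
  linarith

lemma card_smoothResidues_le_gcd {y : ℝ} {r : ℕ} (hr : 1 ≤ r) (c N : ℕ) :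
    (smoothResidues y r c N).card ≤
      (smoothResidues y (r / c.gcd r) (c / c.gcd r) (N / c.gcd r)).card := by
  set d := c.gcd r with hd
  have hd0 : 0 < d := Nat.gcd_pos_of_pos_right c hr
  have hdc : d ∣ c := Nat.gcd_dvd_left c r
  have hdr : d ∣ r := Nat.gcd_dvd_right c r
  have hdvd : ∀ n ∈ smoothResidues y r c N, d ∣ n := by
    intro n hn
    rw [mem_smoothResidues] at hn
    exact (hn.2.2.dvd_iff hdr).2 hdc
  refine Finset.card_le_card_of_injOn (fun n => n / d) ?_ ?_
  · intro n hn
    obtain ⟨m, rfl⟩ := hdvd n hn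
    rw [Finset.mem_coe, mem_smoothResidues] at hn
    obtain ⟨⟨hn1, hnN⟩, hns, hnc⟩ := hn
    rw [Finset.mem_coe, mem_smoothResidues]
    simp only [Nat.mul_div_cancel_left _ hd0]
    refine ⟨⟨Nat.pos_of_mul_pos_left hn1, ?_⟩, hns.of_dvd (dvd_mul_left _ _), ?_⟩
    · rw [Nat.le_div_iff_mul_le hd0, mul_comm]
      exact hnN
    · refine Nat.ModEq.mul_left_cancel' hd0.ne' ?_
      rwa [Nat.mul_div_cancel' hdc, Nat.mul_div_cancel' hdr]
  · intro a ha b hb hab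
    exact (Nat.div_left_inj (hdvd a ha) (hdvd b hb)).1 hab

lemma exists_card_smoothResidues_le :
    ∃ C y₁ : ℝ, 0 < C ∧ 4 ≤ y₁ ∧ ∀ x y α : ℝ, y₁ ≤ y → 3 ≤ x → 1 / 20 ≤ α → α ≤ 1 →
      alphaEq x y α → 4 * Real.log x ≤ Chebyshev.theta y → ∀ X : ℝ, 0 ≤ X → X ≤ x →
        ∀ r : ℕ, 1 ≤ r → ∀ c : ℕ, ((smoothResidues y r c ⌊X⌋₊).card : ℝ) ≤
          C * (Psi X y * (r : ℝ) ^ (-α) * Real.log x) + 3 * y := by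
  obtain ⟨C₁, y₁, hC₁, hy₁, h₁⟩ := exists_card_smoothResidues_coprime_le
  obtain ⟨C₂, hC₂, h₂⟩ := exists_Psi_le_mul_log
  refine ⟨C₁ * C₂, y₁, by positivity, hy₁,
    fun x y α hy hx hα hα1 hsum hθ X hX hXx r hr c => ?_⟩
  have hy4 : 4 ≤ y := hy₁.trans hy
  have hl := one_le_log_of_three_le hx
  have hr1 : (1 : ℝ) ≤ r := by exact_mod_cast hr
  have hr0 : (0 : ℝ) < r := by linarith
  have hflX := Nat.floor_le hX
  rcases lt_or_ge X (2 * (r * y)) with hsmall | hbig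
  · have h3 := card_smoothResidues_le y hr c ⌊X⌋₊
    have h4 : (⌊X⌋₊ : ℝ) / r ≤ 2 * y := by
      rw [div_le_iff₀ hr0]
      linarith
    have : 0 ≤ C₁ * C₂ * (Psi X y * (r : ℝ) ^ (-α) * Real.log x) := by positivity
    linarith
  · set d := c.gcd r with hd
    have hd0 : 0 < d := Nat.gcd_pos_of_pos_right c hr
    have hdr : d ∣ r := Nat.gcd_dvd_right c r
    have hdle : d ≤ r := Nat.le_of_dvd hr hdr
    have hd0' : (0 : ℝ) < d := by exact_mod_cast hd0
    have hd1' : (1 : ℝ) ≤ d := by exact_mod_cast hd0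
    have hdle' : (d : ℝ) ≤ r := by exact_mod_cast hdle
    have hcast : ((r / d : ℕ) : ℝ) = r / d := Nat.cast_div hdr hd0'.ne'
    have hlow : ((r / d : ℕ) : ℝ) * y ≤ ((⌊X⌋₊ / d : ℕ) : ℝ) := by
      have h3 : (⌊X⌋₊ : ℝ) < (((⌊X⌋₊ / d : ℕ) : ℝ) + 1) * d := by
        exact_mod_cast Nat.lt_mul_of_div_lt (Nat.lt_succ_self (⌊X⌋₊ / d)) hd0
      have h4 := Nat.lt_floor_add_one X
      have h5 : r * y ≤ ((⌊X⌋₊ / d : ℕ) : ℝ) * d := by nlinarith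
      rw [hcast, div_mul_eq_mul_div, div_le_iff₀ hd0']
      exact h5
    have hupp : ((⌊X⌋₊ / d : ℕ) : ℝ) ≤ X / d :=
      Nat.cast_div_le.trans (by gcongr)
    have hXd : X / d ≤ X := div_le_self hX hd1'
    have h3 := h₁ x y α hy hx hα hα1 hsum hθ (r / d) (⌊X⌋₊ / d)
      (Nat.div_pos hdle hd0) hlow (hupp.trans (hXd.trans hXx)) (c / d)
      (Nat.coprime_div_gcd_div_gcd hd0)
    have hXd1 : 1 ≤ X / d := by
      rw [le_div_iff₀ hd0']
      nlinarith
    have h4 := h₂ x y α hx (by linarith) hα hα1 hsum (by linarith) (X / d) X hXd1 hXd hXx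
    have h5 : (Psi ((⌊X⌋₊ / d : ℕ) : ℝ) y : ℝ) ≤ Psi (X / d) y := by
      exact_mod_cast Psi_mono hupp
    have hX0 : X ≠ 0 := by
      have : 0 < r * y := by positivity
      linarith
    have h6 : (r / d : ℝ) ^ (-α) * (X / d / X) ^ α = (r : ℝ) ^ (-α) := by
      rw [div_div, mul_comm (d : ℝ) X, ← div_div, div_self hX0, one_div,
        Real.inv_rpow hd0'.le, ← Real.rpow_neg hd0'.le, ← Real.mul_rpow (by positivity) hd0'.le,
        div_mul_cancel₀ _ hd0'.ne']
    calc ((smoothResidues y r c ⌊X⌋₊).card : ℝ) ≤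
          (smoothResidues y (r / d) (c / d) (⌊X⌋₊ / d)).card := by
          exact_mod_cast card_smoothResidues_le_gcd hr c _
      _ ≤ C₁ * ((r / d : ℕ) : ℝ) ^ (-α) * Psi ((⌊X⌋₊ / d : ℕ) : ℝ) y := h3
      _ ≤ C₁ * ((r / d : ℕ) : ℝ) ^ (-α) * (C₂ * Real.log x * (X / d / X) ^ α * Psi X y) := by
        gcongr
        exact h5.trans h4
      _ = C₁ * C₂ * (Psi X y * ((r / d : ℝ) ^ (-α) * (X / d / X) ^ α) * Real.log x) := by
        rw [hcast]; ring
      _ ≤ _ := by rw [h6]; linarith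

lemma Tmax_le_mul_Psi {y X M : ℝ} {r : ℕ} (hM0 : 0 ≤ M)
    (hM : ∀ c : ℕ, ((smoothResidues y r c ⌊X⌋₊).card : ℝ) ≤ M) :
    (Tmax y X r : ℝ) ≤ M * Psi X y := by
  suffices h : Tmax y X r ≤ ⌊M⌋₊ * Psi X y by
    calc (Tmax y X r : ℝ) ≤ ⌊M⌋₊ * Psi X y := by exact_mod_cast h
      _ ≤ _ := by
        gcongr
        exact Nat.floor_le hM0
  refine Finset.sup_le fun b _ => ?_
  set S := countSet (IsSmooth y) ⌊X⌋₊ with hS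
  set F := (S ×ˢ S).filter (fun nn => nn.1 ≡ nn.2 + b [MOD r]) with hF
  have hset : {nn : ℕ × ℕ | 1 ≤ nn.1 ∧ 1 ≤ nn.2 ∧ (nn.1 : ℝ) ≤ X ∧ (nn.2 : ℝ) ≤ X ∧
      IsSmooth y nn.1 ∧ IsSmooth y nn.2 ∧ nn.1 ≡ nn.2 + b [MOD r]} ⊆ (F : Set (ℕ × ℕ)) := by
    rintro ⟨m, n⟩ ⟨h1, h2, h3, h4, h5, h6, h7⟩
    rw [Finset.mem_coe, hF, Finset.mem_filter, Finset.mem_product, hS, mem_countSet, mem_countSet]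
    exact ⟨⟨⟨⟨h1, Nat.le_floor h3⟩, h5⟩, ⟨⟨h2, Nat.le_floor h4⟩, h6⟩⟩, h7⟩
  have h1 : Tcount y X r b ≤ F.card := by
    rw [Tcount, Nat.card_coe_set_eq, ← Set.ncard_coe_finset]
    exact Set.ncard_le_ncard hset F.finite_toSet
  refine h1.trans ?_
  rw [Psi_eq_card]
  refine Finset.card_le_mul_card_image_of_maps_to (f := Prod.snd) (fun nn hnn => ?_) _
    fun n _ => ?_
  · exact (Finset.mem_product.1 (Finset.mem_filter.1 hnn).1).2
  · refine le_trans (Finset.card_le_card_of_injOn (t := smoothResidues y r (n + b) ⌊X⌋₊)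
      Prod.fst ?_ ?_) (Nat.le_floor (hM (n + b)))
    · rintro ⟨m, n'⟩ h
      rw [Finset.mem_coe, Finset.mem_filter, hF, Finset.mem_filter, Finset.mem_product, hS,
        mem_countSet] at h
      obtain ⟨⟨⟨⟨h2, h3⟩, -⟩, h4⟩, rfl⟩ := h
      exact mem_smoothResidues.2 ⟨h2, h3, h4⟩
    · rintro ⟨m, n'⟩ h ⟨m', n''⟩ h' h2
      rw [Finset.mem_coe, Finset.mem_filter] at h h'
      exact Prod.ext h2 (h.2.trans h'.2.symm)

/-- Bound (2.5): for a prime p dividing q,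
𝔗_j(q/p) ≪ Ψ(x/(2^j qLy), y)² (q/p)^(−α) log x + y Ψ(x/(2^j qLy), y). -/
theorem Tmax_q_div_p_bound :
    ∃ C : ℝ, 0 < C ∧
      ∀ (x y : ℝ) (q : ℕ) (δ L : ℝ) (j : ℕ) (p : ℕ) (α : ℝ),
        3 ≤ x → Real.log x ^ (1.1 : ℝ) ≤ y → y ≤ x ^ ((1 : ℝ) / 3) →
        1 ≤ q → L = 2 * (1 + |δ * x|) →
        (j : ℝ) ≤ Real.log y / Real.log 2 →
        p.Prime → p ∣ q → alphaEq x y α →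
        (Tmax y (x / (2 ^ j * q * L * y)) (q / p) : ℝ) ≤
          C * ((Psi (x / (2 ^ j * q * L * y)) y : ℝ) ^ 2 *
              ((q / p : ℕ) : ℝ) ^ (-α) * Real.log x +
            y * (Psi (x / (2 ^ j * q * L * y)) y : ℝ)) := by
  obtain ⟨C, y₁, hC, hy₁, h⟩ := exists_card_smoothResidues_le
  obtain ⟨y₂, hy₂, h'⟩ := exists_alphaEq_bounds
  refine ⟨C + 3 + Real.exp (max y₁ y₂), by positivity,
    fun x y q δ L j p α hx hxy hyx hq hL _ hp hpq hα => ?_⟩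
  have hl := one_le_log_of_three_le hx
  have hy1 : 1 ≤ y := (Real.one_le_rpow hl (by norm_num)).trans hxy
  have hq1 : (1 : ℝ) ≤ q := by exact_mod_cast hq
  have hL1 : 1 ≤ L := by
    rw [hL]
    linarith [abs_nonneg (δ * x)]
  have hden : 1 ≤ 2 ^ j * q * L * y := by
    have h2 : (1 : ℝ) ≤ 2 ^ j := one_le_pow₀ (by norm_num)
    have h3 : 1 ≤ (2 : ℝ) ^ j * q := one_le_mul_of_one_le_of_one_le h2 hq1
    have h4 : 1 ≤ (2 : ℝ) ^ j * q * L := one_le_mul_of_one_le_of_one_le h3 hL1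
    exact one_le_mul_of_one_le_of_one_le h4 hy1
  set X := x / (2 ^ j * q * L * y)
  have hX0 : 0 ≤ X := div_nonneg (by linarith) (by linarith)
  have hXx : X ≤ x := div_le_self (by linarith) hden
  have hr : 1 ≤ q / p := Nat.div_pos (Nat.le_of_dvd hq hpq) hp.pos
  have hP0 : (0 : ℝ) ≤ Psi X y := Nat.cast_nonneg _
  set A := (Psi X y : ℝ) ^ 2 * ((q / p : ℕ) : ℝ) ^ (-α) * Real.log x with hA
  have hA0 : 0 ≤ A := by positivity
  have hB0 : 0 ≤ y * Psi X y := by positivity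
  have hE := Real.exp_pos (max y₁ y₂)
  rcases le_or_gt (max y₁ y₂) y with hy | hy
  · obtain ⟨hθ, hα0, hα1⟩ := h' x y α ((le_max_right _ _).trans hy) hx hxy hyx hα
    have h1 := Tmax_le_mul_Psi (by positivity)
      (h x y α ((le_max_left _ _).trans hy) hx hα0 hα1 hα hθ X hX0 hXx (q / p) hr)
    refine h1.trans ?_
    have h2 : (C * (Psi X y * ((q / p : ℕ) : ℝ) ^ (-α) * Real.log x) + 3 * y) * Psi X y =
        C * A + 3 * (y * Psi X y) := by rw [hA]; ring
    rw [h2]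
    nlinarith
  · have h1 : x ≤ Real.exp (max y₁ y₂) := by
      rw [← Real.log_le_iff_le_exp (by linarith)]
      have h2 := log_le_rpow_of_log_rpow_le hx hxy
      have h3 : y ^ (10 / 11 : ℝ) ≤ y ^ (1 : ℝ) :=
        Real.rpow_le_rpow_of_exponent_le hy1 (by norm_num)
      rw [Real.rpow_one] at h3
      linarith
    have h2 : (Tmax y X (q / p) : ℝ) ≤ x * Psi X y := by
      refine Tmax_le_mul_Psi (by linarith) fun c => ?_
      have h3 : smoothResidues y (q / p) c ⌊X⌋₊ ⊆ Finset.Icc 1 ⌊X⌋₊ :=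
        fun n hn => Finset.mem_Icc.2 (mem_smoothResidues.1 hn).1
      have h4 := Finset.card_le_card h3
      rw [Nat.card_Icc, Nat.add_sub_cancel] at h4
      have h5 : ((smoothResidues y (q / p) c ⌊X⌋₊).card : ℝ) ≤ ⌊X⌋₊ := by exact_mod_cast h4
      exact h5.trans ((Nat.floor_le hX0).trans hXx)
    have h3 : x * Psi X y ≤ Real.exp (max y₁ y₂) * (y * Psi X y) := by
      gcongr
      exact le_mul_of_one_le_left hP0 hy1
    refine h2.trans (h3.trans ?_)
    nlinarith
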